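/- arXiv:2005.08253 — 8 statements merged into one kernel-verified Lean document; each statement's English description precedes it below -/
import Mathlib

section
/- Let K be an algebraically closed field of characteristic 0, let c ≥ 2 and r be integers, and let A be a c×(r+c) matrix of linear forms in 3 variables over K such that: (i) the scalar matrix A(p) has rank c for every p ∈ K³ \ {0}; (ii) there is no nonzero vector v ∈ K^{r+c} with A(p)·v = 0 for all p ∈ K³; (iii) for every 2-dimensional K-linear subspace W ⊆ K³ the space {v ∈ K^{r+c} : A(w)·v = 0 for all w ∈ W} has dimension exactly r − c. Then c + 2 ≤ r ≤ 2c. (This is Theorem 10: a rank r, 1-type uniform Steiner bundle on P² with no trivial summands and c₁ = −c satisfies c+2 ≤ r ≤ 2c.) -/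
open Matrix

/-- Evaluation at a point `p` of the matrix of linear forms `p₀A₀ + ⋯ + p_{N-1}A_{N-1}`. -/
def evalMat {K : Type*} [CommRing K] {c x N : ℕ}
    (A : Fin N → Matrix (Fin c) (Fin x) K) (p : Fin N → K) :
    Matrix (Fin c) (Fin x) K :=
  ∑ k, p k • A k

/-- The common kernel `{v : A(w)·v = 0 for all w ∈ W}`. -/
def commonKernel {K : Type*} [CommRing K] {c x N : ℕ}
    (A : Fin N → Matrix (Fin c) (Fin x) K) (W : Submodule K (Fin N → K)) :
    Submodule K (Fin x → K) :=
  ⨅ w ∈ W, LinearMap.ker (evalMat A w).mulVecLin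


lemma hopf_val {K F ι κ : Type*} [Field K] [IsAlgClosed K] [Field F] [Algebra K F]
    [Fintype ι] [Fintype κ] {n : ℕ}
    (B : Fin n → ι → κ → K)
    (hB : ∀ (s : ι → K) (t : κ → K), (∀ k, ∑ i, ∑ j, s i * t j * B k i j = 0) → s = 0 ∨ t = 0)
    (s : ι → F) (t : κ → F) (V : ValuationSubring F)
    (hK : ∀ a : K, algebraMap K F a ∈ V)
    (hf : ∀ k, ∑ i, ∑ j, s i * t j * algebraMap K F (B k i j) ∈ V) (i : ι) (j : κ) :
    s i * t j ∈ V := by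
  classical
  by_contra hij
  obtain ⟨⟨i0, j0⟩, -, hmax⟩ := Finset.exists_max_image (Finset.univ : Finset (ι × κ))
    (fun x => V.valuation (s x.1 * t x.2)) ⟨(i, j), Finset.mem_univ _⟩
  have hmax' : ∀ i j, V.valuation (s i * t j) ≤ V.valuation (s i0 * t j0) :=
    fun i j => hmax (i, j) (Finset.mem_univ _)
  have h0 : 1 < V.valuation (s i0 * t j0) := by
    rw [← V.valuation_le_one_iff, not_le] at hij
    exact hij.trans_le (hmax' i j)
  have hne : s i0 * t j0 ≠ 0 := by
    intro h
    rw [h, map_zero] at h0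
    exact absurd h0 (by simp)
  have hs0 : s i0 ≠ 0 := left_ne_zero_of_mul hne
  have ht0 : t j0 ≠ 0 := right_ne_zero_of_mul hne
  have hpos : 0 < V.valuation (s i0 * t j0) := lt_trans zero_lt_one h0
  have hdiv : ∀ y, V.valuation y ≤ V.valuation (s i0 * t j0) → y / (s i0 * t j0) ∈ V := by
    intro y hy
    rw [← V.valuation_le_one_iff, map_div₀]
    exact (div_le_one₀ hpos).2 hy
  let f : Fin n → MvPolynomial (ι ⊕ κ) K := fun k =>
    ∑ i, ∑ j, MvPolynomial.X (Sum.inl i) * MvPolynomial.X (Sum.inr j) * MvPolynomial.C (B k i j)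
  let S : Set (MvPolynomial (ι ⊕ κ) K) :=
    Set.range f ∪ {MvPolynomial.X (Sum.inl i0) - 1, MvPolynomial.X (Sum.inr j0) - 1}
  have htop : Ideal.span S = ⊤ := by
    rw [← Ideal.radical_eq_top, ← MvPolynomial.vanishingIdeal_zeroLocus_eq_radical (K := K),
      MvPolynomial.zeroLocus_span]
    convert MvPolynomial.vanishingIdeal_empty
    rw [Set.eq_empty_iff_forall_notMem]
    intro x hx
    rcases hB (fun i => x (Sum.inl i)) (fun j => x (Sum.inr j)) (fun k => by
      have := hx (f k) (Or.inl ⟨k, rfl⟩)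
      simpa [f] using this) with h | h
    · have := hx (MvPolynomial.X (Sum.inl i0) - 1) (Or.inr (by simp))
      have h2 := congrFun h i0
      simp at h2
      simp [h2] at this
    · have := hx (MvPolynomial.X (Sum.inr j0) - 1) (Or.inr (by simp))
      have h2 := congrFun h j0
      simp at h2
      simp [h2] at this
  let y : ι ⊕ κ → F := Sum.elim (fun i => s i / s i0) (fun j => t j / t j0)
  have hyV : ∀ q, y q ∈ V := by
    rintro (i | j)
    · have := hdiv _ (hmax' i j0)
      rwa [mul_div_mul_right _ _ ht0] at this
    · have := hdiv _ (hmax' i0 j)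
      rwa [mul_div_mul_left _ _ hs0] at this
  have hall : ∀ p : MvPolynomial (ι ⊕ κ) K, MvPolynomial.aeval y p ∈ V := by
    intro p
    induction p using MvPolynomial.induction_on with
    | C a => simpa using hK a
    | add p q hp hq => rw [map_add]; exact V.add_mem _ _ hp hq
    | mul_X p q hp => rw [map_mul, MvPolynomial.aeval_X]; exact V.mul_mem _ _ hp (hyV q)
  have hlt : ∀ p ∈ Ideal.span S, V.valuation (MvPolynomial.aeval y p) < 1 := by
    intro p hp
    induction hp using Submodule.span_induction with
    | zero => simp
    | add p q _ _ hp hq => rw [map_add]; exact V.valuation.map_add_lt hp hq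
    | smul a p _ hp =>
      rw [smul_eq_mul, map_mul, map_mul]
      exact (mul_le_of_le_one_left' ((V.valuation_le_one_iff _).2 (hall a))).trans_lt hp
    | mem p hp =>
      rcases hp with ⟨k, rfl⟩ | rfl | rfl
      · have : MvPolynomial.aeval y (f k) =
            (∑ i, ∑ j, s i * t j * algebraMap K F (B k i j)) / (s i0 * t j0) := by
          simp only [f, map_sum, map_mul, MvPolynomial.aeval_X, MvPolynomial.algHom_C, y,
            Sum.elim_inl, Sum.elim_inr, Finset.sum_div]
          refine Finset.sum_congr rfl fun i _ => Finset.sum_congr rfl fun j _ => ?_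
          field_simp
        rw [this, map_div₀, div_lt_one₀ hpos]
        exact ((V.valuation_le_one_iff _).2 (hf k)).trans_lt h0
      · simp [y, hs0]
      · simp [y, ht0]
  have := hlt 1 (htop ▸ Submodule.mem_top)
  simp at this

lemma hopf_int {K F ι κ : Type*} [Field K] [IsAlgClosed K] [Field F] [Algebra K F]
    [Fintype ι] [Fintype κ] {n : ℕ}
    (B : Fin n → ι → κ → K)
    (hB : ∀ (s : ι → K) (t : κ → K), (∀ k, ∑ i, ∑ j, s i * t j * B k i j = 0) → s = 0 ∨ t = 0)
    (s : ι → F) (t : κ → F) (i : ι) (j : κ) :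
    IsAlgebraic (Algebra.adjoin K
      (Set.range fun k => ∑ i, ∑ j, s i * t j * algebraMap K F (B k i j))) (s i * t j) := by
  set R := Set.range fun k => ∑ i, ∑ j, s i * t j * algebraMap K F (B k i j) with hR
  have h : s i * t j ∈ (⨅ V : {V : ValuationSubring F //
      (Set.range (algebraMap K F) ∪ R) ⊆ V.toSubring}, V.1.toSubring) := by
    rw [Subring.mem_iInf]
    rintro ⟨V, hV⟩
    exact hopf_val B hB s t V (fun a => hV (Or.inl ⟨a, rfl⟩))
      (fun k => hV (Or.inr ⟨k, rfl⟩)) i j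
  rw [iInf_valuationSubring_superset, ← Algebra.adjoin_eq_ring_closure] at h
  have h2 : IsIntegral (Algebra.adjoin K R).toSubring (s i * t j) := h
  exact IsIntegral.isAlgebraic (R := Algebra.adjoin K R) h2

lemma hopf {K : Type*} [Field K] [IsAlgClosed K] {n a b : ℕ} (hn : n ≤ a + b)
    (B : Fin n → Fin (a + 1) → Fin (b + 1) → K) :
    ∃ (s : Fin (a + 1) → K) (t : Fin (b + 1) → K), s ≠ 0 ∧ t ≠ 0 ∧
      ∀ k, ∑ i, ∑ j, s i * t j * B k i j = 0 := by
  by_contra! hcon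
  have hB : ∀ (s : Fin (a + 1) → K) (t : Fin (b + 1) → K),
      (∀ k, ∑ i, ∑ j, s i * t j * B k i j = 0) → s = 0 ∨ t = 0 := by
    intro s t h
    by_contra! h2
    obtain ⟨k, hk⟩ := hcon s t h2.1 h2.2
    exact hk (h k)
  let P := MvPolynomial (Fin a ⊕ Fin (b + 1)) K
  let F := FractionRing P
  let x : Fin a ⊕ Fin (b + 1) → F := fun q => algebraMap P F (MvPolynomial.X q)
  have hx : AlgebraicIndependent K x :=
    (MvPolynomial.algebraicIndependent_X (Fin a ⊕ Fin (b + 1)) K).map'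
      (f := IsScalarTower.toAlgHom K P F) (IsFractionRing.injective P F)
  let s : Fin (a + 1) → F := Fin.cons 1 (fun i => x (Sum.inl i))
  let t : Fin (b + 1) → F := fun j => x (Sum.inr j)
  have halg := hopf_int B hB s t
  set R := Set.range fun k => ∑ i, ∑ j, s i * t j * algebraMap K F (B k i j) with hR
  have ht : ∀ j, IsAlgebraic (Algebra.adjoin K R) (t j) := fun j => by
    simpa [s] using halg 0 j
  have hxa : ∀ q, IsAlgebraic (Algebra.adjoin K R) (x q) := by
    rintro (i | j)
    · have h1 := halg i.succ 0
      have h2 := h1.mul (ht 0).inv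
      have h3 : t 0 ≠ 0 := hx.ne_zero _
      rw [mul_assoc, mul_inv_cancel₀ h3, mul_one] at h2
      simpa [s] using h2
    · exact ht j
  have hPa : ∀ p : P, IsAlgebraic (Algebra.adjoin K R) (algebraMap P F p) := by
    intro p
    induction p using MvPolynomial.induction_on with
    | C c =>
      have : algebraMap P F (MvPolynomial.C c) =
        algebraMap (Algebra.adjoin K R) F (algebraMap K _ c) := by
        rw [← IsScalarTower.algebraMap_apply K (Algebra.adjoin K R) F]
        exact (IsScalarTower.algebraMap_apply K P F c).symm
      rw [this]
      exact isAlgebraic_algebraMap _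
    | add p q hp hq => rw [map_add]; exact hp.add hq
    | mul_X p q hp => rw [map_mul]; exact hp.mul (hxa q)
  have : Algebra.IsAlgebraic (Algebra.adjoin K R) F := by
    constructor
    intro z
    obtain ⟨p, q, hq, rfl⟩ := IsFractionRing.div_surjective (A := P) z
    rw [div_eq_mul_inv]
    exact (hPa p).mul (hPa q).inv
  have h1 := Algebra.IsAlgebraic.trdeg_le_cardinalMk K R
  have h2 := hx.lift_cardinalMk_le_trdeg
  have h3 : Cardinal.mk R ≤ (n : Cardinal) := by
    have := Cardinal.mk_range_le_lift (f := fun k => ∑ i, ∑ j, s i * t j * algebraMap K F (B k i j))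
    simpa using this
  have h4 := h1.trans h3
  simp at h2
  have h5 := h2.trans h4
  norm_cast at h5
  omega

lemma mem_commonKernel_basis {K : Type*} [Field K] {c x : ℕ}
    (A : Fin 3 → Matrix (Fin c) (Fin x) K) (W : Submodule K (Fin 3 → K))
    (bW : Module.Basis (Fin 2) K W) (v : Fin x → K)
    (h : ∀ j, (evalMat A (bW j : Fin 3 → K)).mulVec v = 0) : v ∈ commonKernel A W := by
  simp only [commonKernel, Submodule.mem_iInf, LinearMap.mem_ker, Matrix.mulVecLin_apply]
  intro w hw
  have hsum := bW.sum_repr ⟨w, hw⟩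
  have hsum' : ∑ j, bW.repr ⟨w, hw⟩ j • (bW j : Fin 3 → K) = w := by
    have := congrArg Subtype.val hsum
    simpa [-Module.Basis.sum_repr, Submodule.coe_sum] using this
  let L : (Fin 3 → K) →ₗ[K] (Fin c → K) :=
    { toFun := fun p => (evalMat A p).mulVec v
      map_add' := by
        intro p q
        simp [evalMat, add_smul, Finset.sum_add_distrib, Matrix.add_mulVec]
      map_smul' := by
        intro a p
        simp only [evalMat, Pi.smul_apply, smul_eq_mul, mul_smul, ← Finset.smul_sum,
          Matrix.smul_mulVec, RingHom.id_apply] }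
  change L w = 0
  rw [← hsum', map_sum]
  refine Finset.sum_eq_zero fun j _ => ?_
  rw [map_smul]
  have : L (bW j) = 0 := h j
  rw [this, smul_zero]

lemma finrank_dotKer {K : Type*} [Field K] (t : Fin 3 → K) (ht : t ≠ 0) :
    Module.finrank K (LinearMap.ker (dotProductBilin K K t)) = 2 := by
  have hne : dotProductBilin K K t ≠ 0 := by
    intro h
    apply ht
    ext i
    have := LinearMap.congr_fun h (Pi.single i 1)
    simpa using this
  have := Module.Dual.finrank_ker_add_one_of_ne_zero hne
  simp at this
  omega

/-- **Theorem 10 (bounds).** If `A` is a `c × (r+c)` matrix of linear forms in 3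
variables over an algebraically closed field of characteristic 0 such that
(i) `A(p)` has rank `c` for every `p ≠ 0`, (ii) no nonzero constant vector is killed
by all evaluations `A(p)` (no trivial summands), and (iii) for every 2-dimensional
subspace `W ⊆ K³` the common kernel has dimension exactly `r − c` (1-type uniformity),
then `c + 2 ≤ r ≤ 2c`. -/
theorem stmt0 {K : Type*} [Field K] [IsAlgClosed K] [CharZero K]
    (c r : ℕ) (hc : 2 ≤ c)
    (A : Fin 3 → Matrix (Fin c) (Fin (r + c)) K)
    (hrank : ∀ p : Fin 3 → K, p ≠ 0 → (evalMat A p).rank = c)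
    (hnotriv : ∀ v : Fin (r + c) → K,
      (∀ p : Fin 3 → K, (evalMat A p).mulVec v = 0) → v = 0)
    (huniform : ∀ W : Submodule K (Fin 3 → K), Module.finrank K W = 2 →
      Module.finrank K (commonKernel A W) + c = r) :
    c + 2 ≤ r ∧ r ≤ 2 * c := by
  constructor
  · by_contra! hlt
    let T : (Fin 3 → Fin c → K) →ₗ[K] (Fin (r + c) → K) :=
      ∑ i, (A i).vecMulLinear ∘ₗ LinearMap.proj i
    have hT : ∀ u, T u = ∑ i, u i ᵥ* A i := by
      intro u
      simp [T]
    have hker : c - 1 ≤ Module.finrank K (LinearMap.ker T) := by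
      have h1 := T.finrank_range_add_finrank_ker
      have h2 := Submodule.finrank_le (LinearMap.range T)
      simp [Module.finrank_pi_fintype] at h1 h2
      omega
    obtain ⟨a, rfl⟩ : ∃ a, c = a + 2 := ⟨c - 2, by omega⟩
    obtain ⟨u, hu⟩ := exists_linearIndependent_of_le_finrank
      (R := K) (M := LinearMap.ker T) (n := a + 1) (by omega)
    obtain ⟨s, t, hs, ht, hst⟩ := hopf (K := K) (n := a + 2) (a := a) (b := 2) le_rfl
      (fun k l i => (u l : Fin 3 → Fin (a + 2) → K) i k)
    set z : LinearMap.ker T := ∑ l, s l • u l with hz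
    have hz0 : z ≠ 0 := by
      intro h
      apply hs
      ext l
      exact Fintype.linearIndependent_iff.1 hu s h l
    have hzt : ∀ k, ∑ i, t i * (z : Fin 3 → Fin (a + 2) → K) i k = 0 := by
      intro k
      rw [← hst k, Finset.sum_comm]
      refine Finset.sum_congr rfl fun i _ => ?_
      simp only [hz, Submodule.coe_sum, Submodule.coe_smul, Finset.sum_apply, Pi.smul_apply,
        smul_eq_mul, Finset.mul_sum]
      refine Finset.sum_congr rfl fun l _ => ?_
      ring
    set W := LinearMap.ker (dotProductBilin K K t) with hW
    have hW2 : Module.finrank K W = 2 := finrank_dotKer t ht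
    have hu2 := huniform W hW2
    let bW : Module.Basis (Fin 2) K W := Module.finBasisOfFinrankEq K W hW2
    let Φ : (Fin (r + (a + 2)) → K) →ₗ[K] (Fin 2 → Fin (a + 2) → K) :=
      LinearMap.pi fun j => (evalMat A (bW j : Fin 3 → K)).mulVecLin
    have hΦker : LinearMap.ker Φ ≤ commonKernel A W := by
      intro v hv
      refine mem_commonKernel_basis A W bW v fun j => ?_
      exact congrFun (LinearMap.mem_ker.1 hv) j
    have hsurj : Function.Surjective Φ := by
      rw [← LinearMap.range_eq_top]
      apply Submodule.eq_top_of_finrank_eq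
      have h1 := Φ.finrank_range_add_finrank_ker
      have h2 := Submodule.finrank_mono hΦker
      have h3 := Submodule.finrank_le (LinearMap.range Φ)
      simp [Module.finrank_pi_fintype] at h1 h3 ⊢
      omega
    have hmem : ∀ k, (fun i => (z : Fin 3 → Fin (a + 2) → K) i k) ∈ W := by
      intro k
      rw [hW, LinearMap.mem_ker]
      simpa [dotProduct] using hzt k
    let y : Fin 2 → Fin (a + 2) → K := fun j k => bW.repr ⟨_, hmem k⟩ j
    have hy : ∀ i k, (z : Fin 3 → Fin (a + 2) → K) i k = ∑ j, y j k * (bW j : Fin 3 → K) i := by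
      intro i k
      have := congrArg (fun w : W => (w : Fin 3 → K) i) (bW.sum_repr ⟨_, hmem k⟩)
      simpa [-Module.Basis.sum_repr, y] using this.symm
    have hTz : ∑ i, (z : Fin 3 → Fin (a + 2) → K) i ᵥ* A i = 0 := by
      rw [← hT]; exact z.2
    have hTy : ∀ v, ∑ j, y j ⬝ᵥ Φ v j = 0 := by
      intro v
      have h1 : (∑ i, (z : Fin 3 → Fin (a + 2) → K) i ᵥ* A i) ⬝ᵥ v = 0 := by
        rw [hTz, zero_dotProduct]
      rw [← h1]
      have h2 : ∀ i, (z : Fin 3 → Fin (a + 2) → K) i = ∑ j, (bW j : Fin 3 → K) i • y j := by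
        intro i
        ext k
        rw [hy i k]
        simp [mul_comm]
      simp_rw [h2, sum_dotProduct, ← dotProduct_mulVec, sum_dotProduct, smul_dotProduct]
      rw [Finset.sum_comm]
      refine Finset.sum_congr rfl fun j _ => ?_
      simp only [Φ, LinearMap.pi_apply, Matrix.mulVecLin_apply, evalMat, Matrix.sum_mulVec,
        dotProduct_sum, Matrix.smul_mulVec, dotProduct_smul]
    apply hz0
    ext i k
    rw [hy i k]
    refine Finset.sum_eq_zero fun j _ => ?_
    have hyjk : y j k = 0 := by
      obtain ⟨v, hv⟩ := hsurj (Pi.single j (Pi.single k 1))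
      have := hTy v
      rw [hv, Finset.sum_eq_single j] at this
      · simpa using this
      · intro j' _ hj'
        simp [Pi.single_eq_of_ne hj']
      · simp
    rw [hyjk, zero_mul]
  · let t : Fin 3 → K := Pi.single 2 1
    have ht : t ≠ 0 := by simp [t]
    have hu := huniform _ (finrank_dotKer t ht)
    set W := LinearMap.ker (dotProductBilin K K t) with hW
    have hinj : Function.Injective ((A 2).mulVecLin.domRestrict (commonKernel A W)) := by
      rw [← LinearMap.ker_eq_bot, LinearMap.ker_eq_bot']
      rintro ⟨v, hv⟩ h2
      have h2' : A 2 *ᵥ v = 0 := h2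
      simp only [commonKernel, Submodule.mem_iInf, LinearMap.mem_ker,
        Matrix.mulVecLin_apply] at hv
      have h0 : A 0 *ᵥ v = 0 := by
        simpa [evalMat, Fin.sum_univ_three] using hv (Pi.single 0 1) (by simp [hW, t])
      have h1 : A 1 *ᵥ v = 0 := by
        simpa [evalMat, Fin.sum_univ_three] using hv (Pi.single 1 1) (by simp [hW, t])
      have : v = 0 := hnotriv v fun p => by
        simp [evalMat, Fin.sum_univ_three, Matrix.add_mulVec, Matrix.smul_mulVec, h0, h1, h2']
      simp [this]
    have := LinearMap.finrank_le_finrank_of_injective hinj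
    simp at this
    omega
end

section
/- Let K be an algebraically closed field of characteristic 0. For every integer c ≥ 2 and every integer r with c + 2 ≤ r ≤ 2c, there exists a c×(r+c) matrix A of linear forms in 3 variables over K such that: (i) rank A(p) = c for every p ∈ K³ \ {0}; (ii) there is no nonzero v ∈ K^{r+c} with A(p)·v = 0 for all p ∈ K³; (iii) for every 2-dimensional subspace W ⊆ K³ the space {v ∈ K^{r+c} : A(w)·v = 0 for all w ∈ W} has dimension r − c. (This is the sharpness/existence part of Theorem 10: every rank r in [c+2, 2c] is realized by a 1-type uniform Steiner bundle on P² with c₁ = −c and no trivial summands.) -/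
open Matrix

/-- Linear recurrences of order at most two can be solved. -/
lemma rec_solve {K : Type*} [Field K] (l : Fin 3 → K) (hl : l ≠ 0) (z : ℕ → K) :
    ∃ y : ℕ → K, ∀ j, l 0 * y j + l 1 * y (j + 1) + l 2 * y (j + 2) = z j := by
  by_cases h2 : l 2 = 0
  · by_cases h1 : l 1 = 0
    · have h0 : l 0 ≠ 0 := by
        intro h0
        apply hl
        funext k
        fin_cases k <;> simp [h0, h1, h2]
      refine ⟨fun j => z j / l 0, fun j => ?_⟩
      rw [h1, h2]
      field_simp
      ring
    · refine ⟨fun j => Nat.rec (motive := fun _ => K) 0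
        (fun n a => (z n - l 0 * a) / l 1) j, fun j => ?_⟩
      rw [h2]
      simp only
      field_simp
      ring
  · let s : ℕ → K × K := fun j => Nat.rec (motive := fun _ => K × K) (0, 0)
        (fun n a => (a.2, (z n - l 0 * a.1 - l 1 * a.2) / l 2)) j
    refine ⟨fun j => (s j).1, fun j => ?_⟩
    have e1 : (s (j + 1)).1 = (s j).2 := rfl
    have e2 : (s (j + 2)).1 = (z j - l 0 * (s j).1 - l 1 * (s j).2) / l 2 := rfl
    simp only [e1, e2]
    field_simp
    ring

/-- The linear equations cutting out the space of triples. -/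
def bandMap (K : Type*) [Field K] (c d : ℕ) (h : d + 2 ≤ c) :
    (Fin 3 → Fin c → K) →ₗ[K] (Fin d → K) where
  toFun M j := M 0 ⟨j, by omega⟩ + M 1 ⟨j + 1, by omega⟩ + M 2 ⟨j + 2, by omega⟩
  map_add' M N := by
    funext j
    simp only [Pi.add_apply]
    ring
  map_smul' a M := by
    funext j
    simp only [Pi.smul_apply, smul_eq_mul, RingHom.id_apply]
    ring

/-- `y ↦ ℓ ⊗ y`. -/
def outerMap {K : Type*} [Field K] (c : ℕ) (l : Fin 3 → K) :
    (Fin c → K) →ₗ[K] (Fin 3 → Fin c → K) where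
  toFun y k := l k • y
  map_add' y z := by
    funext k
    simp
  map_smul' a y := by
    funext k
    simp [smul_smul, mul_comm]

lemma band_outer_surj {K : Type*} [Field K] (c d : ℕ) (h : d + 2 ≤ c) (l : Fin 3 → K)
    (hl : l ≠ 0) : Function.Surjective (bandMap K c d h ∘ₗ outerMap c l) := by
  intro z
  obtain ⟨y, hy⟩ := rec_solve l hl (fun j => if hj : j < d then z ⟨j, hj⟩ else 0)
  refine ⟨fun i => y i, ?_⟩
  funext j
  have := hy j
  simp only [j.2, dite_true] at this
  simpa [bandMap, outerMap] using this

theorem stmt1 {K : Type*} [Field K] [IsAlgClosed K] [CharZero K]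
    (c r : ℕ) (hc : 2 ≤ c) (hlow : c + 2 ≤ r) (hhigh : r ≤ 2 * c) :
    ∃ A : Fin 3 → Matrix (Fin c) (Fin (r + c)) K,
      (∀ p : Fin 3 → K, p ≠ 0 → (evalMat A p).rank = c) ∧
      (∀ v : Fin (r + c) → K,
        (∀ p : Fin 3 → K, (evalMat A p).mulVec v = 0) → v = 0) ∧
      (∀ W : Submodule K (Fin 3 → K), Module.finrank K W = 2 →
        Module.finrank K (commonKernel A W) + c = r) := by
  obtain ⟨d, hd⟩ : ∃ d, d + r = 2 * c := ⟨2 * c - r, by omega⟩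
  have h : d + 2 ≤ c := by omega
  let L := bandMap K c d h
  have hker : Module.finrank K (LinearMap.ker L) = r + c := by
    have hs : Function.Surjective L := by
      have := band_outer_surj (K := K) c d h (fun _ => 1) (by
        intro h0
        simpa using congrFun h0 0)
      rw [LinearMap.coe_comp] at this
      exact this.of_comp
    have := L.finrank_range_add_finrank_ker
    rw [LinearMap.range_eq_top.2 hs, finrank_top] at this
    simp only [Module.finrank_pi_fintype, Module.finrank_self, Finset.sum_const,
      Finset.card_univ, Fintype.card_fin, smul_eq_mul] at this
    omega
  let φ : (Fin (r + c) → K) ≃ₗ[K] LinearMap.ker L :=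
    LinearEquiv.ofFinrankEq _ _ (by rw [hker]; simp)
  let Φ : (Fin (r + c) → K) →ₗ[K] (Fin 3 → Fin c → K) :=
    (LinearMap.ker L).subtype ∘ₗ φ.toLinearMap
  have hΦinj : Function.Injective Φ :=
    (Subtype.val_injective).comp φ.injective
  have hΦL : ∀ v, L (Φ v) = 0 := fun v => (φ v).2
  have hΦs : ∀ M, L M = 0 → ∃ v, Φ v = M := fun M hM =>
    ⟨φ.symm ⟨M, hM⟩, by simp [Φ]⟩
  let A : Fin 3 → Matrix (Fin c) (Fin (r + c)) K :=
    fun k => LinearMap.toMatrix' (LinearMap.proj k ∘ₗ Φ)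
  have hA : ∀ p v, (evalMat A p).mulVec v = ∑ k, p k • Φ v k := by
    intro p v
    simp only [evalMat, Matrix.sum_mulVec, Matrix.smul_mulVec]
    refine Finset.sum_congr rfl fun k _ => ?_
    simp only [A, LinearMap.toMatrix'_mulVec]
    rfl
  refine ⟨A, ?_, ?_, ?_⟩
  · intro p hp
    have hsurj : Function.Surjective (evalMat A p).mulVecLin := by
      intro y
      obtain ⟨i, hi⟩ := Function.ne_iff.1 hp
      simp only [Pi.zero_apply] at hi
      obtain ⟨l, hl, hpl⟩ : ∃ l : Fin 3 → K, l ≠ 0 ∧ ∑ k, p k * l k = 0 := by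
        by_cases h01 : p 0 = 0
        · refine ⟨![1, 0, 0], fun h0 => by simpa using congrFun h0 0, ?_⟩
          simp [Fin.sum_univ_three, h01]
        · refine ⟨![p 1, - p 0, 0], fun h0 => h01 (by simpa using congrFun h0 1), ?_⟩
          simp [Fin.sum_univ_three]
          ring
      let q : Fin 3 → K := Pi.single i (p i)⁻¹
      obtain ⟨y', hy'⟩ := band_outer_surj c d h l hl (- L (outerMap c q y))
      obtain ⟨v, hv⟩ := hΦs (outerMap c q y + outerMap c l y') (by
        rw [map_add]
        have : L (outerMap c l y') = - L (outerMap c q y) := hy'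
        rw [this]
        simp)
      refine ⟨v, ?_⟩
      rw [Matrix.mulVecLin_apply, hA, hv]
      have e1 : ∑ k, p k * q k = 1 := by
        simp [q, Pi.single_apply, hi]
      calc ∑ k, p k • (outerMap c q y + outerMap c l y') k
          = (∑ k, p k * q k) • y + (∑ k, p k * l k) • y' := by
            rw [Finset.sum_smul, Finset.sum_smul, ← Finset.sum_add_distrib]
            refine Finset.sum_congr rfl fun k _ => ?_
            simp [outerMap, smul_smul]
        _ = y := by rw [e1, hpl]; simp
    rw [Matrix.rank, LinearMap.range_eq_top.2 hsurj, finrank_top]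
    simp
  · intro v hv
    apply hΦinj
    rw [map_zero]
    funext k
    have := hv (Pi.single k 1)
    rw [hA] at this
    simpa [Pi.single_apply] using this
  · intro W hW
    obtain ⟨f, hf, hWf⟩ := Submodule.exists_le_ker_of_lt_top W (by
      rw [lt_top_iff_ne_top]
      rintro rfl
      rw [finrank_top] at hW
      simp at hW)
    have hWeq : W = LinearMap.ker f := by
      apply Submodule.eq_of_le_of_finrank_le hWf
      have h1 := f.finrank_range_add_finrank_ker
      have h2 : LinearMap.range f = ⊤ :=
        LinearMap.range_eq_top.2 (LinearMap.surjective hf)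
      rw [h2, finrank_top] at h1
      simp at h1
      omega
    let l : Fin 3 → K := fun k => f (Pi.single k 1)
    have hfl : ∀ w, f w = ∑ k, w k * l k := by
      intro w
      rw [LinearMap.pi_apply_eq_sum_univ f w]
      refine Finset.sum_congr rfl fun k _ => ?_
      rw [smul_eq_mul]
      congr 2
      funext j
      simp [Pi.single_apply, eq_comm]
    have hl : l ≠ 0 := by
      intro h0
      apply hf
      refine LinearMap.ext fun w => ?_
      simp [hfl, h0]
    obtain ⟨i, hi⟩ := Function.ne_iff.1 hl
    simp only [Pi.zero_apply] at hi
    have hTinj : Function.Injective (outerMap c l) := by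
      intro y z hyz
      have := congrFun hyz i
      exact smul_right_injective _ hi this
    have hmap : (commonKernel A W).map Φ =
        (LinearMap.ker (L ∘ₗ outerMap c l)).map (outerMap c l) := by
      ext M
      simp only [Submodule.mem_map, commonKernel, Submodule.mem_iInf, LinearMap.mem_ker,
        Matrix.mulVecLin_apply, hA, LinearMap.comp_apply, hWeq]
      constructor
      · rintro ⟨v, hv, rfl⟩
        have key : outerMap c l ((l i)⁻¹ • Φ v i) = Φ v := by
          funext k
          have := hv (Pi.single k (l i) - Pi.single i (l k)) (by
            rw [hfl]
            simp [sub_mul, Pi.single_apply, mul_comm (l i) (l k)])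
          simp only [Pi.sub_apply, sub_smul, Finset.sum_sub_distrib, Pi.single_apply,
            ite_smul, zero_smul, Finset.sum_ite_eq', Finset.mem_univ, if_true,
            sub_eq_zero] at this
          change l k • (l i)⁻¹ • Φ v i = Φ v k
          rw [smul_comm, ← this, smul_smul, inv_mul_cancel₀ hi, one_smul]
        exact ⟨_, by rw [key]; exact hΦL v, key⟩
      · rintro ⟨y, hy, rfl⟩
        obtain ⟨v, hv⟩ := hΦs _ hy
        refine ⟨v, fun w hw => ?_, hv⟩
        rw [hv]
        rw [hfl] at hw
        calc ∑ k, w k • outerMap c l y k = (∑ k, w k * l k) • y := by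
              rw [Finset.sum_smul]
              refine Finset.sum_congr rfl fun k _ => ?_
              simp [outerMap, smul_smul]
          _ = 0 := by rw [hw, zero_smul]
    have e1 := (Submodule.equivMapOfInjective Φ hΦinj (commonKernel A W)).finrank_eq
    have e2 := (Submodule.equivMapOfInjective (outerMap c l) hTinj
      (LinearMap.ker (L ∘ₗ outerMap c l))).finrank_eq
    have e3 := (L ∘ₗ outerMap c l).finrank_range_add_finrank_ker
    rw [LinearMap.range_eq_top.2 (band_outer_surj c d h l hl), finrank_top] at e3
    simp only [Module.finrank_fintype_fun_eq_card, Fintype.card_fin] at e3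
    rw [e1, hmap, ← e2]
    omega
end

section
/- Let K be an algebraically closed field of characteristic 0 and c ≥ 2 an integer. Let A be a c×3c matrix of linear forms in 3 variables over K such that: (i) rank A(p) = c for every p ∈ K³ \ {0}; (ii) there is no nonzero v ∈ K^{3c} with A(p)·v = 0 for all p ∈ K³; (iii) for every 2-dimensional subspace W ⊆ K³ the space {v ∈ K^{3c} : A(w)·v = 0 for all w ∈ W} has dimension c. Then there exist invertible matrices P ∈ GL(c, K) and Q ∈ GL(3c, K) such that for all p = (p₀,p₁,p₂) ∈ K³ the matrix P·A(p)·Q is block-diagonal with c blocks each equal to the 1×3 matrix [p₀ p₁ p₂]. (This is Remark 11: a 1-type uniform Steiner bundle on P² with c₁ = −c, no trivial summands, and maximal rank r = 2c is isomorphic to the direct sum of c copies of Ω_{P²}(1).) -/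
open Matrix

/-- The `c × 3c` block-diagonal matrix with `c` diagonal blocks each equal to the
`1 × 3` matrix `[p₀ p₁ p₂]` (the defining matrix of `Ω_{P²}(1)^c`). -/
def omegaBlocks {K : Type*} [CommRing K] (c : ℕ) (p : Fin 3 → K) :
    Matrix (Fin c) (Fin (3 * c)) K :=
  fun i j => if (j : ℕ) / 3 = (i : ℕ) then p ⟨(j : ℕ) % 3, by omega⟩ else 0

/-- **Remark 11.** A 1-type uniform Steiner bundle on P² with `c₁ = −c`, no trivial
summands and maximal rank `r = 2c` is isomorphic to `Ω_{P²}(1)^c`: its defining matrix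
is `GL(c) × GL(3c)`-equivalent to the block diagonal matrix with `c` blocks `[p₀ p₁ p₂]`. -/
theorem stmt2 {K : Type*} [Field K] [IsAlgClosed K] [CharZero K]
    (c : ℕ) (hc : 2 ≤ c)
    (A : Fin 3 → Matrix (Fin c) (Fin (3 * c)) K)
    (hrank : ∀ p : Fin 3 → K, p ≠ 0 → (evalMat A p).rank = c)
    (hnotriv : ∀ v : Fin (3 * c) → K,
      (∀ p : Fin 3 → K, (evalMat A p).mulVec v = 0) → v = 0)
    (huniform : ∀ W : Submodule K (Fin 3 → K), Module.finrank K W = 2 →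
      Module.finrank K (commonKernel A W) = c) :
    ∃ (P : Matrix (Fin c) (Fin c) K) (Q : Matrix (Fin (3 * c)) (Fin (3 * c)) K),
      IsUnit P ∧ IsUnit Q ∧
      ∀ p : Fin 3 → K, P * evalMat A p * Q = omegaBlocks c p := by
  let M : Matrix (Fin (3 * c)) (Fin (3 * c)) K := fun j l =>
    A ⟨(j : ℕ) % 3, by omega⟩ ⟨(j : ℕ) / 3, by omega⟩ l
  have hrow : ∀ (k : Fin 3) (i : Fin c) (h : 3 * (i : ℕ) + k < 3 * c),
      M ⟨3 * (i : ℕ) + k, h⟩ = A k i := by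
    intro k i h
    have h1 : (⟨(3 * (i : ℕ) + k) % 3, by omega⟩ : Fin 3) = k := Fin.ext (by simp only; omega)
    have h2 : (⟨(3 * (i : ℕ) + k) / 3, by omega⟩ : Fin c) = i := Fin.ext (by simp only; omega)
    funext l
    change A ⟨(3 * (i : ℕ) + k) % 3, _⟩ ⟨(3 * (i : ℕ) + k) / 3, _⟩ l = _
    rw [h1, h2]
  have hM : IsUnit M := by
    rw [← Matrix.mulVec_injective_iff_isUnit]
    refine (injective_iff_map_eq_zero M.mulVecLin).2 ?_
    intro v hv
    apply hnotriv
    intro p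
    have hk : ∀ k, (A k).mulVec v = 0 := by
      intro k
      funext i
      have := congrFun hv ⟨3 * (i : ℕ) + k, by omega⟩
      simp only [Matrix.mulVecLin_apply, Matrix.mulVec] at this
      rw [hrow] at this
      exact this
    simp [evalMat, Matrix.sum_mulVec, Matrix.smul_mulVec, hk]
  obtain ⟨u, hu⟩ := hM
  refine ⟨1, (↑u⁻¹ : Matrix (Fin (3 * c)) (Fin (3 * c)) K), isUnit_one, Units.isUnit _, ?_⟩
  intro p
  have hMQ : M * (↑u⁻¹ : Matrix (Fin (3 * c)) (Fin (3 * c)) K) = 1 := by rw [← hu]; exact u.mul_inv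
  have hA : ∀ (k : Fin 3) (i : Fin c) (j : Fin (3 * c)), (A k * (↑u⁻¹ : Matrix (Fin (3 * c)) (Fin (3 * c)) K)) i j
      = if 3 * (i : ℕ) + k = (j : ℕ) then 1 else 0 := by
    intro k i j
    have := congrFun (congrFun hMQ ⟨3 * (i : ℕ) + k, by omega⟩) j
    rw [Matrix.mul_apply, hrow, Matrix.one_apply] at this
    rw [Matrix.mul_apply, this]
    simp [Fin.ext_iff]
  ext i j
  rw [Matrix.one_mul, evalMat, Matrix.sum_mul, Matrix.sum_apply]
  simp only [Matrix.smul_mul, Matrix.smul_apply, hA, omegaBlocks, smul_eq_mul, mul_ite,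
    mul_one, mul_zero]
  split_ifs with h
  · rw [Finset.sum_eq_single (⟨(j : ℕ) % 3, by omega⟩ : Fin 3)]
    · rw [if_pos]
      simp only
      omega
    · intro b _ hb
      rw [if_neg]
      intro h'
      apply hb
      apply Fin.ext
      simp only
      omega
    · simp
  · apply Finset.sum_eq_zero
    intro k _
    rw [if_neg]
    omega
end

section
/- Let K be an algebraically closed field of characteristic 0, let n ≥ 2, c ≥ 2 and r be integers, and let A be a c×(r+c) matrix of linear forms in n+1 variables over K such that: (i) rank A(p) = c for every p ∈ K^{n+1} \ {0}; (ii) there is no nonzero v ∈ K^{r+c} with A(p)·v = 0 for all p ∈ K^{n+1}; (iii) for every 2-dimensional subspace W ⊆ K^{n+1} the space {v ∈ K^{r+c} : A(w)·v = 0 for all w ∈ W} has dimension exactly r − c. Then c + 2(n−1) ≤ r ≤ cn. (This is Theorem 13: a rank r, 1-type uniform Steiner bundle on Pⁿ with no trivial summands and c₁ = −c satisfies c + 2(n−1) ≤ r ≤ cn.) -/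
open Matrix

open MvPolynomial

theorem hc_aeval {K σ τ : Type*} [Field K] (z : σ → MvPolynomial τ K)
    (hz : ∀ v, (z v).IsHomogeneous 2) (d : ℕ) (f : MvPolynomial σ K) :
    aeval z (homogeneousComponent d f) = homogeneousComponent (2 * d) (aeval z f) := by
  conv_rhs => rw [← sum_homogeneousComponent f]
  rw [map_sum, map_sum]
  have h : ∀ i, homogeneousComponent (2 * d) (aeval z (homogeneousComponent i f)) =
      if d = i then aeval z (homogeneousComponent i f) else 0 := by
    intro i
    rw [homogeneousComponent_of_mem
      (((homogeneousComponent_isHomogeneous i f).aeval z hz))]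
    simp
  simp only [h]
  rw [Finset.sum_ite_eq]
  split_ifs with h1
  · rfl
  · rw [homogeneousComponent_eq_zero, map_zero]
    simpa [Nat.lt_succ_iff] using h1

theorem hc_mul {K σ : Type*} [Field K] (q L : MvPolynomial σ K)
    (hL : L.IsHomogeneous 1) (d : ℕ) :
    homogeneousComponent (d + 1) (q * L) = homogeneousComponent d q * L := by
  conv_lhs => rw [← sum_homogeneousComponent q]
  rw [Finset.sum_mul, map_sum]
  have h : ∀ i, homogeneousComponent (d + 1) (homogeneousComponent i q * L) =
      if d = i then homogeneousComponent i q * L else 0 := by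
    intro i
    rw [homogeneousComponent_of_mem ((homogeneousComponent_isHomogeneous i q).mul hL)]
    simp
  simp only [h]
  rw [Finset.sum_ite_eq]
  split_ifs with h1
  · rfl
  · rw [homogeneousComponent_eq_zero d, zero_mul]
    simpa [Nat.lt_succ_iff] using h1

theorem integ {K σ τ ι : Type*} [Field K] [Finite σ] [Fintype ι] (z : σ → MvPolynomial τ K)
    (hz : ∀ v, (z v).IsHomogeneous 2) (L : ι → MvPolynomial σ K)
    (hL : ∀ t, (L t).IsHomogeneous 1)
    (hrad : ∀ v, (X v : MvPolynomial σ K) ∈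
      (RingHom.ker (aeval z : MvPolynomial σ K →ₐ[K] _) ⊔ Ideal.span (Set.range L)).radical)
    (v : σ) :
    IsIntegral (Algebra.adjoin K (Set.range fun t => aeval z (L t))) (z v) := by
  by_cases hv : z v = 0
  · rw [hv]; exact isIntegral_zero
  set I := RingHom.ker (aeval z : MvPolynomial σ K →ₐ[K] _) ⊔ Ideal.span (Set.range L) with hI
  have hJ : idealOfVars σ K ≤ I.radical := by
    rw [idealOfVars, Ideal.span_le]
    rintro _ ⟨v, rfl⟩
    exact hrad v
  obtain ⟨D, hD⟩ := Ideal.exists_pow_le_of_le_radical_of_fg hJ (idealOfVars_fg σ K)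
  set T := Algebra.adjoin K (Set.range fun t => aeval z (L t)) with hT
  let H : Submodule K (MvPolynomial τ K) :=
    (homogeneousSubmodule σ K D).map (aeval z : MvPolynomial σ K →ₐ[K] _).toLinearMap
  let N : Submodule T (MvPolynomial τ K) := Submodule.span T (H : Set (MvPolynomial τ K))
  have key : ∀ f : MvPolynomial σ K, f.IsHomogeneous (D + 1) → aeval z f ∈ N := by
    intro f hf
    have hfI : f ∈ I := by
      apply hD
      rw [mem_pow_idealOfVars_iff]
      intro x hx
      have h := hf (mem_support_iff.mp hx)
      rw [Finsupp.degree_eq_weight_one]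
      exact (Nat.le_succ D).trans h.ge
    obtain ⟨p, hp, q, hq, rfl⟩ := Submodule.mem_sup.mp hfI
    obtain ⟨s, rfl⟩ := (Ideal.mem_span_range_iff_exists_fun).mp hq
    rw [RingHom.mem_ker] at hp
    have h1 := homogeneousComponent_eq_self hf
    have h2 : aeval z (homogeneousComponent (D + 1) p) = 0 := by
      rw [hc_aeval z hz]
      change homogeneousComponent _ ((aeval z : MvPolynomial σ K →ₐ[K] _) p) = 0
      erw [hp]; simp
    rw [← h1, map_add, map_add, h2, zero_add, map_sum, map_sum]
    refine Submodule.sum_mem _ fun t _ => ?_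
    rw [hc_mul _ _ (hL t), map_mul, mul_comm]
    have : (⟨aeval z (L t), Algebra.subset_adjoin ⟨t, rfl⟩⟩ : T) •
        aeval z (homogeneousComponent D (s t)) ∈ N := by
      apply N.smul_mem
      exact Submodule.subset_span ⟨_, homogeneousComponent_isHomogeneous _ _, rfl⟩
    exact this
  refine isIntegral_of_smul_mem_submodule N ?_ ?_ (z v) ?_
  · rw [Submodule.ne_bot_iff]
    refine ⟨z v ^ D, Submodule.subset_span ⟨X v ^ D, ?_, by simp⟩, pow_ne_zero _ hv⟩
    simpa using (isHomogeneous_X K v).pow D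
  · have hfg : H.FG := (homogeneousSubmodule_fg σ K D).map _
    obtain ⟨S, hS⟩ := hfg
    refine ⟨S, ?_⟩
    apply le_antisymm
    · apply Submodule.span_mono
      rw [← hS]
      exact Submodule.subset_span
    · apply Submodule.span_le.mpr
      rw [← hS]
      intro x hx
      exact Submodule.span_le_restrictScalars K T (S : Set (MvPolynomial τ K)) hx
  · intro n hn
    induction hn using Submodule.span_induction with
    | mem x hx =>
      obtain ⟨g, hg, rfl⟩ := hx
      have := key (X v * g) (by
        rw [add_comm]; exact (isHomogeneous_X K v).mul hg)
      simpa using this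
    | zero => simp
    | add x y _ _ hx hy => rw [smul_add]; exact N.add_mem hx hy
    | smul a x _ hx =>
      rw [smul_comm]; exact N.smul_mem _ hx

theorem card_le_of_integ {K B ι κ : Type*} [Field K] [CommRing B] [IsDomain B] [Algebra K B]
    [Fintype ι] [Fintype κ] (w : κ → B) (hw : AlgebraicIndependent K w) (l : ι → B)
    (h : ∀ k, IsIntegral (Algebra.adjoin K (Set.range l)) (w k)) :
    Fintype.card κ ≤ Fintype.card ι := by
  have h1 : (AlgebraicIndependent.matroid K B).Indep (Set.range w) :=
    AlgebraicIndependent.matroid_indep_iff.mpr (by exact AlgebraicIndependent.coe_range hw)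
  have h2 : Set.range w ⊆ (AlgebraicIndependent.matroid K B).closure (Set.range l) := by
    rw [AlgebraicIndependent.matroid_closure_eq]
    rintro _ ⟨k, rfl⟩
    exact (h k).isAlgebraic
  have h3 := h1.encard_le_eRk_of_subset h2
  rw [Matroid.eRk_closure_eq] at h3
  have h4 := h3.trans (Matroid.eRk_le_encard _ _)
  have h7 := hw.injective.encard_range
  have h5 : (Set.range l).encard ≤ ENat.card ι := by
    rw [← Set.image_univ, ← Set.encard_univ]; exact Set.encard_image_le _ _
  have h6 := h7.trans (h4.trans h5)
  simpa using h6

theorem row_select {K I J : Type*} [Field K] [Fintype I] [Fintype J] (Z : Matrix I J K)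
    (h : 3 ≤ Z.rank) : ∃ r : Fin 3 → I, (Z.submatrix r id).rank = 3 := by
  obtain ⟨κ, a, ha, hspan, hli⟩ := exists_linearIndependent' K Z.row
  have : Finite κ := Finite.of_injective a ha
  have : Fintype κ := Fintype.ofFinite κ
  have hk : 3 ≤ Fintype.card κ := by
    rw [rank_eq_finrank_span_row, ← hspan] at h
    rwa [linearIndependent_iff_card_eq_finrank_span.mp hli]
  obtain ⟨e⟩ := Function.Embedding.nonempty_of_card_le (α := Fin 3) (β := κ) (by simpa using hk)
  refine ⟨a ∘ e, ?_⟩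
  have h2 : LinearIndependent K (Z.submatrix (a ∘ e) id).row := hli.comp e e.injective
  simpa using h2.rank_matrix

theorem rank_le_two {K I J : Type*} [Field K] [Fintype I] [Fintype J] (Z : Matrix I J K)
    (h : ∀ (r : Fin 3 → I) (s : Fin 3 → J), (Z.submatrix r s).det = 0) : Z.rank ≤ 2 := by
  by_contra hcon
  obtain ⟨r, hr⟩ := row_select Z (by omega)
  obtain ⟨s, hs⟩ := row_select (Z.submatrix r id)ᵀ (by rw [rank_transpose, hr])
  have h1 := h r s
  have h2 : ((Z.submatrix r id)ᵀ.submatrix s id) = (Z.submatrix r s)ᵀ := rfl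
  rw [h2, rank_transpose] at hs
  have h3 : IsUnit (Z.submatrix r s) := by
    rw [← linearIndependent_rows_iff_isUnit, linearIndependent_iff_card_eq_finrank_span,
      Set.finrank, ← rank_eq_finrank_span_row, hs]
    simp
  rw [Matrix.isUnit_iff_isUnit_det, h1] at h3
  exact not_isUnit_zero h3

noncomputable def zmat (K I J : Type*) [Field K] :
    I × J → MvPolynomial ((I × Fin 2) ⊕ (Fin 2 × J)) K :=
  fun v => ∑ k : Fin 2, X (Sum.inl (v.1, k)) * X (Sum.inr (k, v.2))

theorem zmat_hom (K I J : Type*) [Field K] (v : I × J) : (zmat K I J v).IsHomogeneous 2 :=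
  IsHomogeneous.sum _ _ _ fun _ _ => (isHomogeneous_X K _).mul (isHomogeneous_X K _)

theorem zmat_eval {K I J : Type*} [Field K] (x : Matrix I (Fin 2) K) (y : Matrix (Fin 2) J K)
    (v : I × J) :
    aeval (Sum.elim (fun p => x p.1 p.2) (fun p => y p.1 p.2)) (zmat K I J v) = (x * y) v.1 v.2 := by
  simp [zmat, Matrix.mul_apply]

theorem minor_ker {K I J : Type*} [Field K] (r : Fin 3 → I) (s : Fin 3 → J) :
    aeval (zmat K I J) (Matrix.det (Matrix.of fun a b =>
      (X (r a, s b) : MvPolynomial (I × J) K))) = 0 := by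
  rw [det_fin_three]
  simp only [of_apply, map_add, map_sub, map_mul, aeval_X, zmat, Fin.sum_univ_two]
  ring

/-- index of free entries -/
def fr (α β : Type*) : (Fin 2 × (Fin 2 ⊕ β)) ⊕ (α × Fin 2) → (Fin 2 ⊕ α) × (Fin 2 ⊕ β) :=
  Sum.elim (fun p => (Sum.inl p.1, p.2)) (fun p => (Sum.inr p.1, Sum.inl p.2))

theorem alg_indep (K α β : Type*) [Field K] [Infinite K] :
    AlgebraicIndependent K (fun s => zmat K (Fin 2 ⊕ α) (Fin 2 ⊕ β) (fr α β s)) := by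
  classical
  rw [algebraicIndependent_iff]
  intro f hf
  let G : Matrix (Fin 2) (Fin 2) (MvPolynomial ((Fin 2 × (Fin 2 ⊕ β)) ⊕ (α × Fin 2)) K) :=
    Matrix.of fun i j => X (Sum.inl (i, Sum.inl j))
  have hG : G.det ≠ 0 := by
    intro h0
    have := congrArg (aeval (Sum.elim
      (fun p : Fin 2 × (Fin 2 ⊕ β) => if Sum.inl p.1 = p.2 then (1 : K) else 0)
      (fun _ : α × Fin 2 => 0))) h0
    simp [G, det_fin_two] at this
  have key : f * G.det = 0 := by
    apply MvPolynomial.funext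
    intro p
    rw [map_mul, map_zero]
    by_cases hd : eval p G.det = 0
    · rw [hd, mul_zero]
    · have : eval p f = 0 := by
        let g : Matrix (Fin 2) (Fin 2) K := Matrix.of fun i j => p (Sum.inl (i, Sum.inl j))
        have hg : IsUnit g.det := by
          rw [isUnit_iff_ne_zero]
          simpa [G, g, det_fin_two] using hd
        let y : Matrix (Fin 2) (Fin 2 ⊕ β) K := Matrix.of fun i j => p (Sum.inl (i, j))
        let w : Matrix α (Fin 2) K := Matrix.of fun i j => p (Sum.inr (i, j))
        let x : Matrix (Fin 2 ⊕ α) (Fin 2) K := Matrix.fromRows 1 (w * g⁻¹)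
        have h1 := congrArg (aeval (Sum.elim (fun p => x p.1 p.2) (fun p => y p.1 p.2))) hf
        rw [map_zero, ← AlgHom.comp_apply, comp_aeval] at h1
        simp only [zmat_eval] at h1
        have h2 : (fun s => (x * y) (fr α β s).1 (fr α β s).2) = p := by
          funext s
          rcases s with ⟨i, j⟩ | ⟨i, j⟩
          · simp [fr, x, y, Matrix.fromRows_mul]
          · have : (w * g⁻¹ * y) i (Sum.inl j) = (w * g⁻¹ * g) i j := by
              simp [Matrix.mul_apply, g, y]
            simp only [fr, x, Matrix.fromRows_mul, Sum.elim_inr, Matrix.fromRows_apply_inr]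
            rw [this, Matrix.nonsing_inv_mul_cancel_right _ _ hg]
            rfl
        rw [h2] at h1
        simpa [aeval_eq_eval] using h1
      rw [this, zero_mul]
  exact (mul_eq_zero.mp key).resolve_right hG


theorem core {K α β τ : Type*} [Field K] [IsAlgClosed K] [Fintype α] [Fintype β] [Fintype τ]
    (a : τ → (Fin 2 ⊕ α) → (Fin 2 ⊕ β) → K)
    (h : ∀ Z : Matrix (Fin 2 ⊕ α) (Fin 2 ⊕ β) K, Z.rank ≤ 2 →
      (∀ t, ∑ i, ∑ j, a t i j * Z i j = 0) → Z = 0) :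
    2 * (2 + Fintype.card β) + 2 * Fintype.card α ≤ Fintype.card τ := by
  have : Infinite K := IsAlgClosed.instInfinite
  let L : τ → MvPolynomial ((Fin 2 ⊕ α) × (Fin 2 ⊕ β)) K :=
    fun t => ∑ i, ∑ j, C (a t i j) * X (i, j)
  have hL : ∀ t, (L t).IsHomogeneous 1 := fun t =>
    IsHomogeneous.sum _ _ _ fun i _ => IsHomogeneous.sum _ _ _ fun j _ => by
      simpa using (isHomogeneous_C _ (a t i j)).mul (isHomogeneous_X K (i, j))
  have hintegral := integ (zmat K (Fin 2 ⊕ α) (Fin 2 ⊕ β)) (zmat_hom K _ _) L hL (by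
    intro v
    rw [← vanishingIdeal_zeroLocus_eq_radical (K := K), mem_vanishingIdeal_iff]
    intro p hp
    rw [mem_zeroLocus_iff] at hp
    have hZ := h (Matrix.of fun i j => p (i, j)) (by
      apply rank_le_two
      intro r s
      have h1 := hp _ (Ideal.mem_sup_left ((RingHom.mem_ker).mpr (minor_ker (K := K) r s)))
      rw [AlgHom.map_det] at h1
      rw [← h1]
      congr 1
      ext i j
      simp) (by
      intro t
      have h1 := hp (L t) (Ideal.mem_sup_right (Ideal.subset_span ⟨t, rfl⟩))
      simpa [L] using h1)
    have := congrFun (congrFun hZ v.1) v.2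
    simpa using this)
  have := card_le_of_integ _ (alg_indep K α β) (fun t => aeval (zmat K _ _) (L t))
    (fun k => hintegral _)
  simpa [Fintype.card_sum, Fintype.card_prod, mul_comm] using this

theorem exists_two {K V : Type*} [Field K] [AddCommGroup V] [Module K V] [FiniteDimensional K V]
    (hV : 2 ≤ Module.finrank K V) (U : Submodule K V) (hU : Module.finrank K U ≤ 2) :
    ∃ W : Submodule K V, U ≤ W ∧ Module.finrank K W = 2 := by
  obtain ⟨U', hU'⟩ := U.exists_isCompl
  have h1 := Submodule.finrank_add_eq_of_isCompl hU'
  obtain ⟨f, hf⟩ := exists_linearIndependent_of_le_finrank (R := K) (M := U')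
    (n := 2 - Module.finrank K U) (by omega)
  let S : Submodule K V := (Submodule.span K (Set.range f)).map U'.subtype
  have hS : Module.finrank K S = 2 - Module.finrank K U := by
    rw [Submodule.finrank_map_subtype_eq, finrank_span_eq_card hf, Fintype.card_fin]
  have hSU : S ≤ U' := Submodule.map_subtype_le _ _
  have hd : U ⊓ S = ⊥ := le_bot_iff.mp ((inf_le_inf_left U hSU).trans hU'.inf_eq_bot.le)
  refine ⟨U ⊔ S, le_sup_left, ?_⟩
  have := Submodule.finrank_sup_add_finrank_inf_eq U S
  rw [hd, finrank_bot, hS] at this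
  omega

theorem evalMat_eq {K : Type*} [Field K] {c x N : ℕ}
    (A : Fin N → Matrix (Fin c) (Fin x) K) (p : Fin N → K) (v : Fin x → K) :
    (evalMat A p).mulVec v = ∑ k, p k • (A k).mulVec v := by
  simp [evalMat, Matrix.sum_mulVec, Matrix.smul_mulVec]

/-- `v ↦ (w ↦ A(w) v)`. -/
noncomputable def evL {K : Type*} [Field K] {c x N : ℕ}
    (A : Fin N → Matrix (Fin c) (Fin x) K) :
    (Fin x → K) →ₗ[K] ((Fin N → K) →ₗ[K] (Fin c → K)) :=
  LinearMap.mk₂ K (fun v w => (evalMat A w).mulVec v)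
    (fun v v' w => Matrix.mulVec_add _ _ _)
    (fun a v w => Matrix.mulVec_smul _ _ _)
    (fun v w w' => by simp [evalMat_eq, add_smul, Finset.sum_add_distrib])
    (fun a v w => by simp [evalMat_eq, Finset.smul_sum, mul_smul])

theorem no_rank_two {K : Type*} [Field K] {n c r : ℕ} (hn : 2 ≤ n)
    (A : Fin (n + 1) → Matrix (Fin c) (Fin (r + c)) K)
    (huniform : ∀ W : Submodule K (Fin (n + 1) → K), Module.finrank K W = 2 →
      Module.finrank K (commonKernel A W) + c = r)
    (Z : Matrix (Fin (n + 1)) (Fin c) K) (hZ : Z.rank ≤ 2)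
    (h : ∀ t, ∑ k, ∑ i, A k i t * Z k i = 0) : Z = 0 := by
  rw [rank_eq_finrank_span_cols] at hZ
  obtain ⟨W, hUW, hW⟩ := exists_two (by simp; omega) _ hZ
  have hcol : ∀ i, Z.col i ∈ W := fun i => hUW (Submodule.subset_span ⟨i, rfl⟩)
  let Ψ : (Fin (r + c) → K) →ₗ[K] (W →ₗ[K] (Fin c → K)) :=
    (LinearMap.lcomp K (Fin c → K) W.subtype) ∘ₗ evL A
  have hΨ : ∀ v w, Ψ v w = (evalMat A w.1).mulVec v := fun v w => rfl
  have hker : LinearMap.ker Ψ = commonKernel A W := by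
    ext v
    simp only [LinearMap.mem_ker, commonKernel, Submodule.mem_iInf, mulVecLin_apply]
    constructor
    · intro hv w hw
      rw [← hΨ v ⟨w, hw⟩, hv]; rfl
    · intro hv
      ext1 w
      rw [hΨ, hv _ w.2]; rfl
  have hsurj : Function.Surjective Ψ := by
    rw [← LinearMap.range_eq_top]
    apply Submodule.eq_top_of_finrank_eq
    have h1 := LinearMap.finrank_range_add_finrank_ker Ψ
    rw [hker] at h1
    have h2 := huniform W hW
    rw [Module.finrank_linearMap, hW]
    simp at h1 ⊢
    omega
  have hpair : ∀ v, ∑ i, Ψ v ⟨Z.col i, hcol i⟩ i = 0 := by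
    intro v
    have h1 : ∀ i, Ψ v ⟨Z.col i, hcol i⟩ i = ∑ t, v t * ∑ k, A k i t * Z k i := by
      intro i
      rw [hΨ, evalMat_eq]
      simp only [Finset.sum_apply, Pi.smul_apply, smul_eq_mul, mulVec, dotProduct, Finset.mul_sum]
      rw [Finset.sum_comm]
      refine Finset.sum_congr rfl fun t _ => Finset.sum_congr rfl fun k _ => ?_
      simp only [col_apply]
      ring
    simp only [h1]
    rw [Finset.sum_comm]
    refine Finset.sum_eq_zero fun t _ => ?_
    rw [← Finset.mul_sum, Finset.sum_comm, h t, mul_zero]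
  have hz : ∀ i, (⟨Z.col i, hcol i⟩ : W) = 0 := by
    intro i
    rw [← Module.forall_dual_apply_eq_zero_iff K]
    intro f
    obtain ⟨v, hv⟩ := hsurj ((LinearMap.single K (fun _ : Fin c => K) i) ∘ₗ f)
    have := hpair v
    rw [hv] at this
    simpa [Pi.single_apply] using this
  ext k i
  have := congrFun (congrArg Subtype.val (hz i)) k
  simpa using this

/-- **Theorem 13 (bounds).** If `A` is a `c × (r+c)` matrix of linear forms in `n+1`
variables over an algebraically closed field of characteristic 0 such that
(i) `A(p)` has rank `c` for every `p ≠ 0`, (ii) no nonzero constant vector is killed by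
all evaluations `A(p)` (no trivial summands), and (iii) for every 2-dimensional subspace
`W ⊆ K^{n+1}` the common kernel has dimension exactly `r − c` (1-type uniformity),
then `c + 2(n−1) ≤ r ≤ cn`. -/
theorem stmt3 {K : Type*} [Field K] [IsAlgClosed K] [CharZero K]
    (n c r : ℕ) (hn : 2 ≤ n) (hc : 2 ≤ c)
    (A : Fin (n + 1) → Matrix (Fin c) (Fin (r + c)) K)
    (hrank : ∀ p : Fin (n + 1) → K, p ≠ 0 → (evalMat A p).rank = c)
    (hnotriv : ∀ v : Fin (r + c) → K,
      (∀ p : Fin (n + 1) → K, (evalMat A p).mulVec v = 0) → v = 0)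
    (huniform : ∀ W : Submodule K (Fin (n + 1) → K), Module.finrank K W = 2 →
      Module.finrank K (commonKernel A W) + c = r) :
    c + 2 * (n - 1) ≤ r ∧ r ≤ c * n := by
  constructor
  · let e₁ : Fin 2 ⊕ Fin (n - 1) ≃ Fin (n + 1) := finSumFinEquiv.trans (finCongr (by omega))
    let e₂ : Fin 2 ⊕ Fin (c - 2) ≃ Fin c := finSumFinEquiv.trans (finCongr (by omega))
    have := core (τ := Fin (r + c)) (fun t i j => A (e₁ i) (e₂ j) t) (by
      intro Z hZ h
      have h0 := no_rank_two hn A huniform (Z.submatrix e₁.symm e₂.symm)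
        (by rwa [rank_submatrix]) (by
          intro t
          rw [← h t, ← e₁.sum_comp]
          refine Finset.sum_congr rfl fun i _ => ?_
          rw [← e₂.sum_comp]
          simp)
      ext i j
      have := congrFun (congrFun h0 (e₁ i)) (e₂ j)
      simpa using this)
    simp at this
    omega
  · have hinj : Function.Injective (evL A) := by
      rw [injective_iff_map_eq_zero]
      intro v hv
      apply hnotriv
      intro p
      exact LinearMap.congr_fun hv p
    have := LinearMap.finrank_le_finrank_of_injective hinj
    rw [Module.finrank_linearMap] at this
    simp at this
    nlinarith
end

section
/- Let K be an algebraically closed field of characteristic 0 and n ≥ 2 an integer. For every integer c ≥ 2 and every integer r with c + 2(n−1) ≤ r ≤ cn, there exists a c×(r+c) matrix A of linear forms in n+1 variables over K such that: (i) rank A(p) = c for every p ∈ K^{n+1} \ {0}; (ii) there is no nonzero v ∈ K^{r+c} with A(p)·v = 0 for all p ∈ K^{n+1}; (iii) for every 2-dimensional subspace W ⊆ K^{n+1} the space {v ∈ K^{r+c} : A(w)·v = 0 for all w ∈ W} has dimension r − c. (This is the sharpness/existence part of Theorem 13: every rank r in [c+2(n−1), cn] is realized by a 1-type uniform Steiner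 bundle on Pⁿ with c₁ = −c and no trivial summands.) -/
open Matrix

namespace Stmt4Aux

/-- The map whose kernel consists of matrices whose antidiagonals are MDS codewords. -/
def diagMap (K : Type*) [Field K] (n c : ℕ) :
    (Fin c × Fin (n + 1) → K) →ₗ[K] (Fin (c + n) → K) × (Fin (c + n - 2) → K) where
  toFun M := (fun d => ∑ q : Fin c × Fin (n + 1), if q.1.val + q.2.val = d.val then M q else 0,
    fun d => ∑ q : Fin c × Fin (n + 1),
      if q.1.val + q.2.val = d.val + 1 then (q.1.val : K) * M q else 0)
  map_add' M N := by
    ext d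
    · simp only [Prod.fst_add, Pi.add_apply, ← Finset.sum_add_distrib]
      refine Finset.sum_congr rfl fun q _ => ?_
      split_ifs <;> simp
    · simp only [Prod.snd_add, Pi.add_apply, ← Finset.sum_add_distrib]
      refine Finset.sum_congr rfl fun q _ => ?_
      split_ifs <;> simp [mul_add]
  map_smul' a M := by
    ext d
    · simp only [Prod.smul_fst, Pi.smul_apply, RingHom.id_apply, smul_eq_mul, Finset.mul_sum]
      refine Finset.sum_congr rfl fun q _ => ?_
      split_ifs <;> simp
    · simp only [Prod.smul_snd, Pi.smul_apply, RingHom.id_apply, smul_eq_mul, Finset.mul_sum]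
      refine Finset.sum_congr rfl fun q _ => ?_
      split_ifs <;> ring

lemma exists_ne_of_sum {K ι : Type*} [Field K] [Fintype ι] (g : ι → K)
    (h : ∑ i, g i = 0) (i : ι) (hi : g i ≠ 0) : ∃ j, j ≠ i ∧ g j ≠ 0 := by
  by_contra! H
  exact hi (by rw [← h, Finset.sum_eq_single i (fun j _ hj => H j hj) (by simp)])

/-- A nonzero matrix in the kernel does not have rank at most two. -/
lemma ker_rank {K : Type*} [Field K] [CharZero K] (n c : ℕ)
    (y₁ y₂ : Fin c → K) (w₁ w₂ : Fin (n + 1) → K)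
    (h : (fun q : Fin c × Fin (n + 1) => y₁ q.1 * w₁ q.2 + y₂ q.1 * w₂ q.2) ∈
      LinearMap.ker (diagMap K n c)) :
    (fun q : Fin c × Fin (n + 1) => y₁ q.1 * w₁ q.2 + y₂ q.1 * w₂ q.2) = 0 := by
  classical
  set M := (fun q : Fin c × Fin (n + 1) => y₁ q.1 * w₁ q.2 + y₂ q.1 * w₂ q.2) with hM
  by_contra hne
  have hex : ∃ d, ∃ q : Fin c × Fin (n + 1), q.1.val + q.2.val = d ∧ M q ≠ 0 := by
    obtain ⟨q, hq⟩ := Function.ne_iff.mp hne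
    exact ⟨_, q, rfl, hq⟩
  obtain ⟨p, hpd, hp⟩ := Nat.find_spec hex
  have hmin : ∀ q : Fin c × Fin (n + 1), q.1.val + q.2.val < Nat.find hex → M q = 0 := by
    intro q hq
    by_contra hq'
    exact Nat.find_min hex hq ⟨q, rfl, hq'⟩
  generalize Nat.find hex = d at *
  rw [LinearMap.mem_ker] at h
  have h1 : ∀ e : Fin (c + n),
      ∑ q : Fin c × Fin (n + 1), (if q.1.val + q.2.val = e.val then M q else 0) = 0 :=
    fun e => congrFun (congrArg Prod.fst h) e
  have h2 : ∀ e : Fin (c + n - 2), ∑ q : Fin c × Fin (n + 1),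
      (if q.1.val + q.2.val = e.val + 1 then (q.1.val : K) * M q else 0) = 0 :=
    fun e => congrFun (congrArg Prod.snd h) e
  have hd1 : d < c + n := by omega
  have s1 := h1 ⟨d, hd1⟩
  obtain ⟨p', hpp, hp'⟩ := exists_ne_of_sum _ s1 p (by simp [hpd, hp])
  have hpd' : p'.1.val + p'.2.val = d := by
    by_contra hh; simp [hh] at hp'
  simp only [hpd', if_true] at hp'
  have key : ∀ q q' : Fin c × Fin (n + 1), q.1.val + q.2.val = d → q'.1.val + q'.2.val = d →
      q ≠ q' → q.1.val ≠ q'.1.val := by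
    intro q q' hq hq' hne' he
    exact hne' (Prod.ext (Fin.ext he) (Fin.ext (by omega)))
  have hk := key _ _ hpd' hpd hpp
  have hd2 : d - 1 < c + n - 2 := by omega
  have hd3 : d - 1 + 1 = d := by omega
  have s2 := h2 ⟨d - 1, hd2⟩
  simp only [hd3] at s2
  have s3 : ∑ q : Fin c × Fin (n + 1),
      (if q.1.val + q.2.val = d then ((q.1.val : K) - (p'.1.val : K)) * M q else 0) = 0 := by
    have : ∀ q : Fin c × Fin (n + 1),
      (if q.1.val + q.2.val = d then ((q.1.val : K) - (p'.1.val : K)) * M q else 0) =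
      (if q.1.val + q.2.val = d then (q.1.val : K) * M q else 0) -
      (p'.1.val : K) * (if q.1.val + q.2.val = d then M q else 0) := by
      intro q; split_ifs <;> ring
    simp only [this, Finset.sum_sub_distrib, ← Finset.mul_sum]
    simp only at s1
    rw [s1, s2]; simp
  obtain ⟨p'', hpp'', hp''⟩ := exists_ne_of_sum _ s3 p (by
    simp only [hpd, if_true]
    refine mul_ne_zero (sub_ne_zero.mpr ?_) hp
    exact fun hh => hk (Nat.cast_injective hh).symm)
  have hpd'' : p''.1.val + p''.2.val = d := by
    by_contra hh; simp [hh] at hp''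
  simp only [hpd'', if_true] at hp''
  have hk2 := key _ _ hpd'' hpd hpp''
  have hk3 : p''.1.val ≠ p'.1.val := by
    intro hh; simp [hh] at hp''
  have hp3 : M p'' ≠ 0 := right_ne_zero_of_mul hp''
  have fin : ∀ a b e : Fin c × Fin (n + 1), a.1.val + a.2.val = d → b.1.val + b.2.val = d →
      e.1.val + e.2.val = d → M a ≠ 0 → M b ≠ 0 → M e ≠ 0 → a.1.val < b.1.val →
      b.1.val < e.1.val → False := by
    intro a b e ha hb he na nb ne hab hbe
    have z1 := hmin (a.1, b.2) (by simp only; omega)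
    have z2 := hmin (a.1, e.2) (by simp only; omega)
    have z3 := hmin (b.1, e.2) (by simp only; omega)
    have hdet : M a * M b * M e = 0 := by
      have e0 : M a * (M b * M e - M (b.1, e.2) * M (e.1, b.2))
        - M (a.1, b.2) * (M (b.1, a.2) * M e - M (b.1, e.2) * M (e.1, a.2))
        + M (a.1, e.2) * (M (b.1, a.2) * M (e.1, b.2) - M b * M (e.1, a.2)) = 0 := by
        simp only [hM]; ring
      rw [z1, z2, z3] at e0
      linear_combination e0
    exact mul_ne_zero (mul_ne_zero na nb) ne hdet
  rcases lt_or_gt_of_ne hk with g1 | g1 <;> rcases lt_or_gt_of_ne hk2 with g2 | g2 <;>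
    rcases lt_or_gt_of_ne hk3 with g3 | g3
  · exact fin _ _ _ hpd'' hpd' hpd hp3 hp' hp g3 g1
  · exact fin _ _ _ hpd' hpd'' hpd hp' hp3 hp g3 g2
  · omega
  · exact fin _ _ _ hpd' hpd hpd'' hp' hp hp3 g1 g2
  · exact fin _ _ _ hpd'' hpd hpd' hp3 hp hp' g2 g1
  · omega
  · exact fin _ _ _ hpd hpd'' hpd' hp hp3 hp' g2 g3
  · exact fin _ _ _ hpd hpd' hpd'' hp hp' hp3 g1 g3

lemma exists_sub {K T : Type*} [Field K] [AddCommGroup T] [Module K T] [FiniteDimensional K T]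
    (U₀ : Submodule K T) (m : ℕ) (h : m ≤ Module.finrank K U₀) :
    ∃ U ≤ U₀, Module.finrank K U = m := by
  obtain ⟨f, hf⟩ := exists_linearIndependent_of_le_finrank h
  refine ⟨(Submodule.span K (Set.range f)).map U₀.subtype, Submodule.map_subtype_le _ _, ?_⟩
  rw [Submodule.finrank_map_subtype_eq, finrank_span_eq_card hf]
  simp

lemma sum_eval {K : Type*} [Field K] {n c x : ℕ}
    (φ : (Fin c × Fin (n + 1) → K) →ₗ[K] (Fin x → K)) (y : Fin c → K) (p : Fin (n + 1) → K) :
    ∑ i, y i • (evalMat (fun k => Matrix.of fun i => φ (Pi.single (i, k) 1)) p) i =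
      φ (fun q => y q.1 * p q.2) := by
  have hs : (fun q : Fin c × Fin (n + 1) => y q.1 * p q.2) =
      ∑ i, ∑ k, (y i * p k) • (Pi.single (i, k) (1 : K)) := by
    rw [← Fintype.sum_prod_type']
    ext q
    simp [Finset.sum_apply, Pi.single_apply]
  rw [hs, map_sum]
  refine Finset.sum_congr rfl fun i _ => ?_
  rw [map_sum]
  ext j
  simp [evalMat, Matrix.sum_apply, Finset.sum_apply, Finset.mul_sum, mul_assoc]

end Stmt4Aux

open Stmt4Aux

/-- **Theorem 13 (sharpness/existence).** For every `n ≥ 2`, `c ≥ 2` and every `r` with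
`c + 2(n−1) ≤ r ≤ cn`, there is a `c × (r+c)` matrix of linear forms in `n+1` variables
over an algebraically closed field of characteristic 0 defining a 1-type uniform Steiner
bundle on Pⁿ with `c₁ = −c`, no trivial summands, and rank `r`. -/
theorem stmt4 {K : Type*} [Field K] [IsAlgClosed K] [CharZero K]
    (n c r : ℕ) (hn : 2 ≤ n) (hc : 2 ≤ c)
    (hlow : c + 2 * (n - 1) ≤ r) (hhigh : r ≤ c * n) :
    ∃ A : Fin (n + 1) → Matrix (Fin c) (Fin (r + c)) K,
      (∀ p : Fin (n + 1) → K, p ≠ 0 → (evalMat A p).rank = c) ∧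
      (∀ v : Fin (r + c) → K,
        (∀ p : Fin (n + 1) → K, (evalMat A p).mulVec v = 0) → v = 0) ∧
      (∀ W : Submodule K (Fin (n + 1) → K), Module.finrank K W = 2 →
        Module.finrank K (commonKernel A W) + c = r) := by
  classical
  have hT : Module.finrank K (Fin c × Fin (n + 1) → K) = c * n + c := by
    simp [Module.finrank_fintype_fun_eq_card, mul_add]
  obtain ⟨U, hU, hUr⟩ := exists_sub (LinearMap.ker (diagMap K n c)) (c * n - r) (by
    have h1 := LinearMap.finrank_range_add_finrank_ker (diagMap K n c)
    have h2 := Submodule.finrank_le (LinearMap.range (diagMap K n c))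
    rw [hT] at h1
    simp only [Module.finrank_prod, Module.finrank_fintype_fun_eq_card, Fintype.card_fin] at h2
    omega)
  have hQ : Module.finrank K ((Fin c × Fin (n + 1) → K) ⧸ U) =
      Module.finrank K (Fin (r + c) → K) := by
    have := U.finrank_quotient_add_finrank
    rw [hT, hUr] at this
    simp only [Module.finrank_fintype_fun_eq_card, Fintype.card_fin]
    omega
  let e := LinearEquiv.ofFinrankEq _ _ hQ
  let φ : (Fin c × Fin (n + 1) → K) →ₗ[K] (Fin (r + c) → K) := e.toLinearMap ∘ₗ U.mkQ
  have hφs : Function.Surjective φ := e.surjective.comp U.mkQ_surjective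
  have hφ : ∀ (y₁ y₂ : Fin c → K) (w₁ w₂ : Fin (n + 1) → K),
      φ (fun q => y₁ q.1 * w₁ q.2) + φ (fun q => y₂ q.1 * w₂ q.2) = 0 →
      ∀ i k, y₁ i * w₁ k + y₂ i * w₂ k = 0 := by
    intro y₁ y₂ w₁ w₂ h i k
    rw [← map_add] at h
    have h' : (fun q : Fin c × Fin (n + 1) => y₁ q.1 * w₁ q.2 + y₂ q.1 * w₂ q.2) ∈ U := by
      have : e (U.mkQ (fun q : Fin c × Fin (n + 1) => y₁ q.1 * w₁ q.2 + y₂ q.1 * w₂ q.2)) = 0 := h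
      rw [LinearEquiv.map_eq_zero_iff] at this
      simpa using this
    exact congrFun (ker_rank n c y₁ y₂ w₁ w₂ (hU h')) (i, k)
  clear_value φ
  set A : Fin (n + 1) → Matrix (Fin c) (Fin (r + c)) K :=
    fun k => Matrix.of fun i => φ (Pi.single (i, k) 1) with hA
  have hE : ∀ (y : Fin c → K) (p : Fin (n + 1) → K), ∑ i, y i • (evalMat A p) i =
      φ (fun q => y q.1 * p q.2) := sum_eval φ
  refine ⟨A, ?_, ?_, ?_⟩
  · intro p hp
    have : LinearIndependent K (evalMat A p).row := by
      rw [Fintype.linearIndependent_iff]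
      intro y hy i
      have hy' : ∑ i, y i • (evalMat A p) i = 0 := hy
      rw [hE] at hy'
      obtain ⟨k, hk⟩ := Function.ne_iff.mp hp
      have h3 := hφ y 0 p 0 (by
        rw [hy']; simp only [Pi.zero_apply, zero_mul, zero_add]; exact map_zero φ) i k
      simp only [Pi.zero_apply, zero_mul, add_zero, mul_eq_zero] at h3
      exact h3.resolve_right hk
    simpa using this.rank_matrix
  · intro v hv
    have hz : ∀ t, φ t ⬝ᵥ v = 0 := by
      let ψ : (Fin c × Fin (n + 1) → K) →ₗ[K] K := (dotProductBilin K K).flip v ∘ₗ φ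
      have : ψ = 0 := by
        refine (Pi.basisFun K _).ext fun q => ?_
        have h1 := congrFun (hv (Pi.single q.2 1)) q.1
        simpa [ψ, evalMat, Matrix.mulVec, Pi.single_apply, hA] using h1
      intro t
      exact LinearMap.congr_fun this t
    refine dotProduct_eq_zero v fun w => ?_
    obtain ⟨t, rfl⟩ := hφs w
    rw [dotProduct_comm]; exact hz t
  · intro W hW
    let b := Module.finBasisOfFinrankEq K W hW
    let B : Matrix (Fin 2 × Fin c) (Fin (r + c)) K :=
      Matrix.of fun s => evalMat A (b s.1 : Fin (n + 1) → K) s.2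
    have hBli : LinearIndependent K B.row := by
      rw [Fintype.linearIndependent_iff]
      intro y hy
      have hy' : ∑ s, ∑ i, y (s, i) • (evalMat A (b s : Fin (n + 1) → K)) i = 0 := by
        rw [← Fintype.sum_prod_type']; exact hy
      rw [Fin.sum_univ_two, hE (fun i => y (0, i)), hE (fun i => y (1, i))] at hy'
      have h3 := hφ (fun i => y (0, i)) (fun i => y (1, i)) (b 0) (b 1) hy'
      rintro ⟨s, i⟩
      have hb := Fintype.linearIndependent_iff.mp b.linearIndependent (fun s => y (s, i)) (by
        rw [Fin.sum_univ_two]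
        ext k
        simpa using h3 i k)
      exact hb s
    have hBr : B.rank = 2 * c := by simpa using hBli.rank_matrix
    have hker : commonKernel A W = LinearMap.ker B.mulVecLin := by
      ext v
      simp only [commonKernel, Submodule.mem_iInf, LinearMap.mem_ker, Matrix.mulVecLin_apply]
      constructor
      · intro h
        ext s
        exact congrFun (h _ (b s.1).2) s.2
      · intro h w hw
        have hw' := b.sum_repr ⟨w, hw⟩
        rw [Fin.sum_univ_two] at hw'
        have hw2 := congrArg Subtype.val hw'
        simp only [Submodule.coe_add, Submodule.coe_smul] at hw2
        have hadd : ∀ p q, evalMat A (p + q) = evalMat A p + evalMat A q := by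
          intro p q; simp [evalMat, add_smul, Finset.sum_add_distrib]
        have hsm : ∀ (a : K) p, evalMat A (a • p) = a • evalMat A p := by
          intro a p; simp [evalMat, Finset.smul_sum, mul_smul]
        have hb : ∀ s, evalMat A (b s : Fin (n + 1) → K) *ᵥ v = 0 := by
          intro s; ext i; exact congrFun h (s, i)
        rw [← hw2, hadd, hsm, hsm, Matrix.add_mulVec, Matrix.smul_mulVec, Matrix.smul_mulVec,
          hb, hb]
        simp
    rw [hker]
    have h5 := LinearMap.finrank_range_add_finrank_ker B.mulVecLin
    rw [← Matrix.rank, hBr] at h5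
    simp only [Module.finrank_fintype_fun_eq_card, Fintype.card_fin] at h5
    omega
end

section
/- Let K be an algebraically closed field of characteristic 0 and let n ≥ 2 and c ≥ 2 be integers. Let H be a K-linear subspace of the space of (n+1)×c matrices over K such that every nonzero element of H has rank at least 3. Then dim_K H ≤ (n−1)(c−2) = (n+1)c − 2c − 2n + 2. (This is the paper's bound on the maximal dimension of the subspace H ⊆ (S¹V)^{⊕c} = V^{⊕c} in Drézet's construction for p = 1: the condition that H ∩ D^{⊕c} = {0} for every 2-dimensional subspace D ⊆ V = K^{n+1} — equivalently, that every nonzero element of H, viewed as an (n+1)×c matrix, has rank ≥ 3 — forces dim H ≤ (n+1)c − 2c − 2n + 2; it is equivalent to the lower bound of Theorem 13 for the rank of 1-type uniform Steiner bundles on Pⁿ.) -/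
open Matrix

theorem aux_rows {F : Type*} [Field F] {ι κ : Type*} [Fintype ι] [Fintype κ] (M : Matrix ι κ F)
    (h : 3 ≤ M.rank) : ∃ f : Fin 3 → ι, LinearIndependent F (M.submatrix f id).row := by
  obtain ⟨τ, a, ha, hs, hl⟩ := exists_linearIndependent' F M.row
  have : Finite τ := Finite.of_injective a ha
  have := Fintype.ofFinite τ
  rw [Matrix.rank_eq_finrank_span_row, ← hs, finrank_span_eq_card hl] at h
  have : Nonempty (Fin 3 ↪ τ) := by
    apply Function.Embedding.nonempty_of_card_le
    simpa using h
  obtain ⟨e⟩ := this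
  exact ⟨a ∘ e, hl.comp e e.injective⟩

theorem aux_minor {F : Type*} [Field F] {ι κ : Type*} [Fintype ι] [Fintype κ] (M : Matrix ι κ F)
    (h : 3 ≤ M.rank) : ∃ (f : Fin 3 → ι) (g : Fin 3 → κ), (M.submatrix f g).det ≠ 0 := by
  obtain ⟨f, hf⟩ := aux_rows M h
  have h1 := hf.rank_matrix
  obtain ⟨g, hg⟩ := aux_rows (M.submatrix f id)ᵀ (by rw [Matrix.rank_transpose, h1]; simp)
  refine ⟨f, g, ?_⟩
  rw [Matrix.linearIndependent_rows_iff_isUnit, Matrix.isUnit_iff_isUnit_det] at hg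
  have h2 : ((M.submatrix f id)ᵀ.submatrix g id) = (M.submatrix f g)ᵀ := by ext; rfl
  rw [h2, det_transpose] at hg
  exact hg.ne_zero

theorem aux_hom {K A : Type*} [Field K] [IsAlgClosed K] [CommRing A] [Algebra K A]
    [Algebra.FiniteType K A] (I : Ideal A) (hI : I ≠ ⊤) :
    ∃ φ : A →ₐ[K] K, ∀ x ∈ I, φ x = 0 := by
  obtain ⟨m, hm, hle⟩ := I.exists_le_maximal hI
  let _ : Field (A ⧸ m) := Ideal.Quotient.field m
  have : Module.Finite K (A ⧸ m) := finite_of_finite_type_of_isJacobsonRing K (A ⧸ m)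
  have hb : Function.Bijective (algebraMap K (A ⧸ m)) :=
    IsAlgClosed.algebraMap_bijective_of_isIntegral
  let e : K ≃ₐ[K] (A ⧸ m) := AlgEquiv.ofBijective (Algebra.ofId K (A ⧸ m)) hb
  refine ⟨e.symm.toAlgHom.comp (Ideal.Quotient.mkₐ K m), fun x hx => ?_⟩
  have : Ideal.Quotient.mk m x = 0 := Ideal.Quotient.eq_zero_iff_mem.2 (hle hx)
  simp [this]

theorem aux_integral {K Q : Type*} [Field K] [IsAlgClosed K] [Field Q] [Algebra K Q]
    {ι κ τ : Type*} [Fintype ι] [Fintype κ] (x : Matrix ι κ Q)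
    (hx : ∀ (f : Fin 3 → ι) (g : Fin 3 → κ), (x.submatrix f g).det = 0)
    (a : τ → ι → κ → K)
    (h : ∀ M : Matrix ι κ K, (∀ (f : Fin 3 → ι) (g : Fin 3 → κ), (M.submatrix f g).det = 0) →
      (∀ t, ∑ i, ∑ j, a t i j * M i j = 0) → M = 0) (i : ι) (j : κ) :
    IsIntegral (Algebra.adjoin K
      (Set.range fun t => ∑ i, ∑ j, algebraMap K Q (a t i j) * x i j)) (x i j) := by
  set l : τ → Q := fun t => ∑ i, ∑ j, algebraMap K Q (a t i j) * x i j with hl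
  have key : x i j ∈ (⨅ V : {V : ValuationSubring Q //
      (Set.range (algebraMap K Q) ∪ Set.range l) ⊆ V.toSubring}, V.1.toSubring) := by
    rw [Subring.mem_iInf]
    rintro ⟨V, hV⟩
    by_contra hij
    have : Nonempty (ι × κ) := ⟨(i, j)⟩
    obtain ⟨⟨i0, j0⟩, hmax⟩ := Finite.exists_max (fun p : ι × κ => V.valuation (x p.1 p.2))
    set x0 := x i0 j0 with hx0
    have hlt : 1 < V.valuation x0 := by
      refine lt_of_lt_of_le ?_ (hmax (i, j))
      rw [← not_le, V.valuation_le_one_iff]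
      exact hij
    have hx0' : x0 ≠ 0 := by
      intro h0
      rw [h0, map_zero] at hlt
      exact absurd hlt (not_lt.2 zero_le_one)
    have hv0 : 0 < V.valuation x0 := lt_trans zero_lt_one hlt
    let y : Matrix ι κ Q := fun i j => x0⁻¹ * x i j
    have hyV : ∀ i j, y i j ∈ V := by
      intro i j
      rw [← V.valuation_le_one_iff, map_mul, map_inv₀]
      rw [inv_mul_le_iff₀ hv0, mul_one]
      exact hmax (i, j)
    let S : Set Q := Set.range fun p : ι × κ => y p.1 p.2
    let A := Algebra.adjoin K S
    have hAV : A.toSubring ≤ V.toSubring := by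
      rw [Algebra.adjoin_eq_ring_closure, Subring.closure_le]
      apply Set.union_subset (Set.subset_union_left.trans hV)
      rintro _ ⟨p, rfl⟩
      exact hyV p.1 p.2
    have hyA : ∀ i j, y i j ∈ A := fun i j => Algebra.subset_adjoin ⟨(i, j), rfl⟩
    have hAfin : Algebra.FiniteType K A := by
      rw [← Subalgebra.fg_iff_finiteType]
      exact Subalgebra.fg_def.2 ⟨S, Set.finite_range _, rfl⟩
    let ψ : A →+* V := Subring.inclusion hAV
    obtain ⟨φ, hφ⟩ := aux_hom (K := K) (A := A) ((IsLocalRing.maximalIdeal V).comap ψ)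
      (Ideal.comap_ne_top _ (IsLocalRing.maximalIdeal.isMaximal V).ne_top)
    let yA : Matrix ι κ A := fun i j => ⟨y i j, hyA i j⟩
    have hz := h (fun i j => φ (yA i j)) ?_ ?_
    · have h1 : yA i0 j0 = 1 := by
        apply Subtype.ext
        change x0⁻¹ * x0 = 1
        exact inv_mul_cancel₀ hx0'
      have h2 := congrFun (congrFun hz i0) j0
      simp only [h1, map_one] at h2
      exact one_ne_zero h2
    · intro f g
      have h1 : (yA.submatrix f g).det = 0 := by
        apply Subtype.val_injective
        have h2 : A.val ((yA.submatrix f g).det) = (A.val.mapMatrix (yA.submatrix f g)).det :=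
          AlgHom.map_det _ _
        have h3 : A.val.mapMatrix (yA.submatrix f g) = x0⁻¹ • x.submatrix f g := by
          ext; rfl
        rw [h3, Matrix.det_smul, hx, mul_zero] at h2
        exact h2
      have h4 : φ ((yA.submatrix f g).det) = (φ.mapMatrix (yA.submatrix f g)).det :=
          AlgHom.map_det _ _
      rw [h1, map_zero] at h4
      exact h4.symm
    · intro t
      have h1 : ∑ i, ∑ j, a t i j * φ (yA i j)
          = φ (∑ i, ∑ j, algebraMap K A (a t i j) * yA i j) := by
        simp
      rw [h1]
      apply hφ
      rw [Ideal.mem_comap, V.valuation_lt_one_iff]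
      have h2 : ((ψ (∑ i, ∑ j, algebraMap K A (a t i j) * yA i j) : V) : Q) = x0⁻¹ * l t := by
        change A.val _ = _
        simp only [map_sum, map_mul, hl, Finset.mul_sum]
        refine Finset.sum_congr rfl fun i _ => Finset.sum_congr rfl fun j _ => ?_
        change algebraMap K Q (a t i j) * (x0⁻¹ * x i j) = _
        ring
      rw [h2, map_mul, map_inv₀, inv_mul_lt_iff₀ hv0, mul_one]
      refine lt_of_le_of_lt ?_ hlt
      rw [V.valuation_le_one_iff]
      exact hV (Or.inr ⟨t, rfl⟩)
  rw [iInf_valuationSubring_superset, ← Algebra.adjoin_eq_ring_closure] at key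
  exact key

theorem aux_param {K : Type*} [Field K] [IsAlgClosed K] (p q k : ℕ)
    (a : Fin k → Fin (p + 2) → Fin (q + 2) → K)
    (h : ∀ M : Matrix (Fin (p + 2)) (Fin (q + 2)) K,
      (∀ (f : Fin 3 → Fin (p + 2)) (g : Fin 3 → Fin (q + 2)), (M.submatrix f g).det = 0) →
      (∀ t, ∑ i, ∑ j, a t i j * M i j = 0) → M = 0) :
    p * 2 + 2 * (q + 2) ≤ k := by
  let σ := (Fin p × Fin 2) ⊕ (Fin 2 × Fin (q + 2))
  let P := MvPolynomial σ K
  let Q := FractionRing P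
  let v : σ → Q := fun s => algebraMap P Q (MvPolynomial.X s)
  let Y : Matrix (Fin p) (Fin 2) Q := fun i t => v (Sum.inl (i, t))
  let B : Matrix (Fin 2) (Fin (q + 2)) Q := fun t j => v (Sum.inr (t, j))
  let A : Matrix (Fin (p + 2)) (Fin 2) Q :=
    Fin.cons ![1, 0] (Fin.cons ![0, 1] fun i => Y i : Fin (p + 1) → Fin 2 → Q)
  let x := A * B
  have hx : ∀ (f : Fin 3 → Fin (p + 2)) (g : Fin 3 → Fin (q + 2)), (x.submatrix f g).det = 0 := by
    intro f g
    by_contra hne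
    have h1 := Matrix.rank_of_det_ne_zero hne
    have h2 : x.submatrix f g = A.submatrix f id * B.submatrix id g := by ext; rfl
    have h3 := Matrix.rank_mul_le_left (A.submatrix f id) (B.submatrix id g)
    rw [← h2, h1] at h3
    have h4 := Matrix.rank_le_card_width (A.submatrix f id)
    simp at h3 h4
    omega
  have hint := aux_integral x hx a h
  set l : Fin k → Q := fun t => ∑ i, ∑ j, algebraMap K Q (a t i j) * x i j with hl
  let R := Algebra.adjoin K (Set.range l)
  have halg : ∀ i j, IsAlgebraic R (x i j) := fun i j => (hint i j).isAlgebraic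
  have hxm : ∀ i j, x i j = A i 0 * B 0 j + A i 1 * B 1 j := fun i j => by
    change (A * B) i j = _
    rw [Matrix.mul_apply, Fin.sum_univ_two]
  have hx0 : ∀ j, x 0 j = B 0 j := fun j => by
    rw [hxm]
    change 1 * B 0 j + 0 * B 1 j = _
    ring
  have hx1 : ∀ j, x 1 j = B 1 j := fun j => by
    rw [hxm]
    change 0 * B 0 j + 1 * B 1 j = _
    ring
  have hx2 : ∀ (i : Fin p) j, x i.succ.succ j = Y i 0 * B 0 j + Y i 1 * B 1 j :=
    fun i j => hxm _ _
  have hB : ∀ t j, IsAlgebraic R (B t j) := by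
    intro t j
    fin_cases t
    · exact hx0 j ▸ halg 0 j
    · exact hx1 j ▸ halg 1 j
  have hdet : B 0 0 * B 1 1 - B 0 1 * B 1 0 ≠ 0 := by
    let d : P := MvPolynomial.X (Sum.inr (0, 0)) * MvPolynomial.X (Sum.inr (1, 1)) -
      MvPolynomial.X (Sum.inr (0, 1)) * MvPolynomial.X (Sum.inr (1, 0))
    have hd : B 0 0 * B 1 1 - B 0 1 * B 1 0 = algebraMap P Q d := by
      simp [d, B, v]
    rw [hd]
    intro h0
    have h1 : d = 0 := by
      apply IsFractionRing.injective P Q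
      rw [h0, map_zero]
    have h2 := congrArg (MvPolynomial.eval
      (Sum.elim (fun _ => 0) (fun s => if s.1.val = s.2.val then 1 else 0) : σ → K)) h1
    simp [d] at h2
  have hD : IsAlgebraic R (B 0 0 * B 1 1 - B 0 1 * B 1 0) :=
    ((hB _ _).mul (hB _ _)).sub ((hB _ _).mul (hB _ _))
  have hY : ∀ i t, IsAlgebraic R (Y i t) := by
    intro i t
    fin_cases t
    · have : Y i 0 = (x i.succ.succ 0 * B 1 1 - x i.succ.succ 1 * B 1 0) *
          (B 0 0 * B 1 1 - B 0 1 * B 1 0)⁻¹ := by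
        rw [eq_mul_inv_iff_mul_eq₀ hdet, hx2, hx2]; ring
      change IsAlgebraic R (Y i 0)
      rw [this]
      exact (((halg _ _).mul (hB _ _)).sub ((halg _ _).mul (hB _ _))).mul hD.inv
    · have : Y i 1 = (x i.succ.succ 1 * B 0 0 - x i.succ.succ 0 * B 0 1) *
          (B 0 0 * B 1 1 - B 0 1 * B 1 0)⁻¹ := by
        rw [eq_mul_inv_iff_mul_eq₀ hdet, hx2, hx2]; ring
      change IsAlgebraic R (Y i 1)
      rw [this]
      exact (((halg _ _).mul (hB _ _)).sub ((halg _ _).mul (hB _ _))).mul hD.inv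
  have hv : ∀ s, IsAlgebraic R (v s) := by
    rintro (⟨i, t⟩ | ⟨t, j⟩)
    · exact hY i t
    · exact hB t j
  have hP : ∀ f : P, IsAlgebraic R (algebraMap P Q f) := by
    intro f
    induction f using MvPolynomial.induction_on with
    | C r =>
      have : algebraMap P Q (MvPolynomial.C r) = algebraMap R Q (algebraMap K R r) := by
        rw [← IsScalarTower.algebraMap_apply K R Q, ← MvPolynomial.algebraMap_eq,
          ← IsScalarTower.algebraMap_apply K P Q]
      rw [this]
      exact isAlgebraic_algebraMap _
    | add f g hf hg => rw [map_add]; exact hf.add hg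
    | mul_X f s hf => rw [map_mul]; exact hf.mul (hv s)
  have hQ : Algebra.IsAlgebraic R Q := by
    constructor
    intro z
    obtain ⟨f, g, -, rfl⟩ := IsFractionRing.div_surjective (A := P) z
    rw [div_eq_mul_inv]
    exact (hP f).mul (hP g).inv
  have h1 : Algebra.trdeg K Q ≤ Cardinal.mk (Set.range l) :=
    Algebra.IsAlgebraic.trdeg_le_cardinalMk K (Set.range l)
  have h2 : Algebra.trdeg K P ≤ Algebra.trdeg K Q :=
    trdeg_le_of_injective (IsScalarTower.toAlgHom K P Q) (IsFractionRing.injective P Q)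
  have h3 : Algebra.trdeg K P = _ := MvPolynomial.trdeg_of_isDomain
  have h4 := Cardinal.mk_range_le_lift (f := l)
  rw [h3] at h2
  have h5 := h2.trans h1
  rw [← Cardinal.lift_le.{0}] at h5
  have h6 := h5.trans h4
  simp [σ] at h6
  exact_mod_cast h6

/-- **Bound on `dim H` in Drézet's construction for `p = 1`.** If every nonzero element
of a linear subspace `H` of the space of `(n+1) × c` matrices has rank at least 3
(equivalently `H ∩ D^{⊕c} = 0` for every 2-dimensional subspace `D ⊆ K^{n+1}`), then
`dim H ≤ (n−1)(c−2) = (n+1)c − 2c − 2n + 2`. -/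
theorem stmt5 {K : Type*} [Field K] [IsAlgClosed K] [CharZero K]
    (n c : ℕ) (hn : 2 ≤ n) (hc : 2 ≤ c)
    (H : Submodule K (Matrix (Fin (n + 1)) (Fin c) K))
    (hH : ∀ M ∈ H, M ≠ 0 → 3 ≤ M.rank) :
    Module.finrank K H ≤ (n - 1) * (c - 2) := by
  obtain ⟨p, rfl⟩ : ∃ p, n = p + 1 := ⟨n - 1, by omega⟩
  obtain ⟨q, rfl⟩ : ∃ q, c = q + 2 := ⟨c - 2, by omega⟩
  let e := (Module.finBasis K (Matrix (Fin (p + 1 + 1)) (Fin (q + 2)) K ⧸ H)).equivFun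
  let Λ := e.toLinearMap ∘ₗ H.mkQ
  have hΛ : ∀ M, Λ M = 0 ↔ M ∈ H := by
    intro M
    simp [Λ]
  have hsum : ∀ M t, ∑ i, ∑ j, Λ (Matrix.single i j 1) t * M i j = Λ M t := by
    intro M t
    conv_rhs => rw [Matrix.matrix_eq_sum_single M]
    simp only [map_sum, Finset.sum_apply]
    refine Finset.sum_congr rfl fun i _ => Finset.sum_congr rfl fun j _ => ?_
    have : Matrix.single i j (M i j) = M i j • Matrix.single i j (1 : K) := by
      rw [Matrix.smul_single, smul_eq_mul, mul_one]
    rw [this, map_smul, Pi.smul_apply, smul_eq_mul, mul_comm]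
  have key := aux_param (K := K) p q _ (fun t i j => Λ (Matrix.single i j 1) t) ?_
  · have h1 := H.finrank_quotient_add_finrank
    rw [Module.finrank_matrix] at h1
    simp at h1 ⊢
    nlinarith
  · intro M hM hl
    by_contra hne
    obtain ⟨f, g, hfg⟩ := aux_minor M (hH M ((hΛ M).1 (funext fun t => by
      rw [← hsum]; exact hl t)) hne)
    exact hfg (hM f g)
end

section
/- Let K be an algebraically closed field of characteristic 0 and let n ≥ 2 and c ≥ 2 be integers. Let H be a K-linear subspace of the space of (n+1)×c matrices over K such that every nonzero element of H has rank at least 3. Then there exists a K-linear subspace H′ of the space of (n+1)×c matrices with H ⊆ H′, dim_K H′ = (n−1)(c−2), and every nonzero element of H′ of rank at least 3. (This is Theorem 14: every 1-type uniform Steiner bundle E on Pⁿ with c₁ = −c fits into a short exact sequence 0 → F → E → O^α → 0 where F is a 1-type uniform Steiner bundle of the minimal rank c + 2(n−1); in the Drézet correspondence, the subspace H attached to E extends to a subspace H′ of the maximal dimension (n+1)c − 2c − 2n + 2 still meeting every D^{⊕c} only in 0.) -/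
open Matrix

theorem lemA {K P : Type*} [Field K] [CommRing P] [IsDomain P] [Algebra K P]
    {ι κ : Type*} [Fintype ι] [Fintype κ] (x : ι → P) (y : κ → P)
    (hx : AlgebraicIndependent K x)
    (h : ∀ i, IsAlgebraic (Algebra.adjoin K (Set.range y)) (x i)) :
    Fintype.card ι ≤ Fintype.card κ := by
  classical
  have h1 : (AlgebraicIndependent.matroid K P).Indep (Set.range x) := by
    rw [AlgebraicIndependent.matroid_indep_iff]
    exact hx.to_subtype_range
  have h2 : Set.range x ⊆ (AlgebraicIndependent.matroid K P).closure (Set.range y) := by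
    rw [AlgebraicIndependent.matroid_closure_eq]
    rintro _ ⟨i, rfl⟩
    exact h i
  have h3 := h1.encard_le_eRk_of_subset h2
  rw [Matroid.eRk_closure_eq] at h3
  have h4 := h3.trans (Matroid.eRk_le_encard _ _)
  rw [← Set.image_univ, ← Set.image_univ, hx.injective.encard_image] at h4
  have h5 := h4.trans (Set.encard_image_le _ _)
  simpa using h5

theorem exists_factor {K : Type*} [Field K] {a c : ℕ} (M : Matrix (Fin a) (Fin c) K)
    (h : M.rank ≤ 2) : ∃ (A : Matrix (Fin a) (Fin 2) K) (B : Matrix (Fin 2) (Fin c) K),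
      M = A * B := by
  rw [Matrix.rank_eq_finrank_span_cols] at h
  obtain ⟨f, hf, hs, -⟩ := Submodule.exists_fun_fin_finrank_span_eq K (Set.range M.col)
  generalize Module.finrank K (Submodule.span K (Set.range M.col)) = r at h f hf hs
  let A : Matrix (Fin a) (Fin 2) K :=
    Matrix.of fun i k => if h : k.val < r then f ⟨k, h⟩ i else 0
  have hle : Submodule.span K (Set.range f) ≤ Submodule.span K (Set.range A.col) := by
    apply Submodule.span_mono
    rintro _ ⟨i, rfl⟩
    refine ⟨⟨i, by omega⟩, ?_⟩
    ext j
    simp [A, Matrix.col_apply]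
  have hc : ∀ j, ∃ b : Fin 2 → K, ∑ k, b k • A.col k = M.col j := fun j => by
    rw [← Submodule.mem_span_range_iff_exists_fun]
    apply hle
    rw [hs]
    exact Submodule.subset_span ⟨j, rfl⟩
  choose b hb using hc
  refine ⟨A, Matrix.of fun k j => b j k, ?_⟩
  ext i j
  have := congrFun (hb j) i
  rw [Matrix.mul_apply]
  simp only [Fin.sum_univ_two, Pi.add_apply, Pi.smul_apply, Matrix.col_apply, smul_eq_mul,
    Matrix.of_apply] at this ⊢
  rw [← this]; ring

theorem exists_cols {K : Type*} [Field K] {a c : ℕ} (M : Matrix (Fin a) (Fin c) K)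
    (h : 3 ≤ M.rank) : ∃ s : Fin 3 → Fin c, (M.submatrix id s).rank = 3 := by
  rw [Matrix.rank_eq_finrank_span_cols] at h
  obtain ⟨f, hf, hs, hl⟩ := Submodule.exists_fun_fin_finrank_span_eq K (Set.range M.col)
  choose g hg using hf
  refine ⟨fun i => g (Fin.castLE h i), ?_⟩
  have hl' := hl.comp (Fin.castLE h) (Fin.castLE_injective h)
  rw [Matrix.rank_eq_finrank_span_cols]
  have : (M.submatrix id fun i => g (Fin.castLE h i)).col = f ∘ Fin.castLE h := by
    ext i j
    exact congrFun (hg (Fin.castLE h i)) j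
  rw [this, finrank_span_eq_card hl']
  simp

theorem exists_minor {K : Type*} [Field K] {a c : ℕ} (M : Matrix (Fin a) (Fin c) K)
    (h : 3 ≤ M.rank) : ∃ (r : Fin 3 → Fin a) (s : Fin 3 → Fin c), (M.submatrix r s).det ≠ 0 := by
  obtain ⟨s, hs⟩ := exists_cols M h
  obtain ⟨r, hr⟩ := exists_cols (M.submatrix id s)ᵀ (by rw [Matrix.rank_transpose, hs])
  refine ⟨r, s, ?_⟩
  have h3 : (M.submatrix r s).rank = 3 := by
    rw [← Matrix.rank_transpose]; exact hr
  intro h0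
  obtain ⟨v, hv, hv0⟩ := Matrix.exists_mulVec_eq_zero_iff.mpr h0
  have := LinearMap.finrank_range_add_finrank_ker (M.submatrix r s).mulVecLin
  change (M.submatrix r s).rank + _ = _ at this
  rw [h3] at this
  simp at this
  have : v ∈ LinearMap.ker (M.submatrix r s).mulVecLin := by simpa using hv0
  simp_all

theorem det_zero {K : Type*} [Field K] {a c : ℕ} (A : Matrix (Fin a) (Fin 2) K)
    (B : Matrix (Fin 2) (Fin c) K) (r : Fin 3 → Fin a) (s : Fin 3 → Fin c) :
    ((A * B).submatrix r s).det = 0 := by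
  by_contra h
  have h1 := Matrix.rank_of_det_ne_zero h
  have h2 : (A * B).submatrix r s = A.submatrix r id * B.submatrix id s := by
    ext; simp [Matrix.mul_apply]
  have h3 := Matrix.rank_mul_le_left (A.submatrix r id) (B.submatrix id s)
  have h4 := (A.submatrix r id).rank_le_width
  rw [← h2, h1] at h3
  simp at h3
  omega

theorem homComp_mul {K σ : Type*} [Field K] (g l : MvPolynomial σ K) (hl : l.IsHomogeneous 1)
    (e : ℕ) : MvPolynomial.homogeneousComponent (e + 1) (g * l)
      = MvPolynomial.homogeneousComponent e g * l := by
  let _ := MvPolynomial.gradedAlgebra (σ := σ) (R := K)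
  have h := DirectSum.coe_decompose_mul_add_of_right_mem
    (MvPolynomial.homogeneousSubmodule σ K) (i := e) (j := 1) (a := g) (b := l) hl
  have h2 : ∀ (p : MvPolynomial σ K) (i : ℕ),
    (DirectSum.decompose (MvPolynomial.homogeneousSubmodule σ K) p i : MvPolynomial σ K)
      = MvPolynomial.homogeneousComponent i p :=
    fun p i => MvPolynomial.decomposition.decompose'_apply p i
  rwa [h2, h2] at h

theorem lemB {K P σ κ : Type*} [Field K] [IsAlgClosed K] [CommRing P] [IsDomain P] [Algebra K P]
    [Finite σ] [Fintype κ] (φ : MvPolynomial σ K →ₐ[K] P)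
    (hφ : ∀ f, φ f = 0 → ∀ i, φ (MvPolynomial.homogeneousComponent i f) = 0)
    (L : κ → MvPolynomial σ K) (hL : ∀ k, (L k).IsHomogeneous 1)
    (h0 : ∀ x : σ → K, (∀ f, φ f = 0 → MvPolynomial.aeval x f = 0) →
      (∀ k, MvPolynomial.aeval x (L k) = 0) → x = 0) (f : MvPolynomial σ K) :
    IsIntegral (Algebra.adjoin K (Set.range fun k => φ (L k))) (φ f) := by
  classical
  set S := Algebra.adjoin K (Set.range fun k => φ (L k)) with hS
  let J : Ideal (MvPolynomial σ K) := RingHom.ker φ ⊔ Ideal.span (Set.range L)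
  have hrad : MvPolynomial.idealOfVars σ K ≤ J.radical := by
    rw [← MvPolynomial.vanishingIdeal_zeroLocus_eq_radical (K := K) J]
    refine Ideal.span_le.mpr ?_
    rintro _ ⟨i, rfl⟩
    rw [SetLike.mem_coe, MvPolynomial.mem_vanishingIdeal_iff]
    intro x hx
    rw [MvPolynomial.mem_zeroLocus_iff] at hx
    have : x = 0 := h0 x (fun f hf => hx f (Ideal.mem_sup_left hf))
      (fun k => hx _ (Ideal.mem_sup_right (Ideal.subset_span ⟨k, rfl⟩)))
    simp [this]
  obtain ⟨D, hD⟩ := J.exists_radical_pow_le_of_fg (IsNoetherian.noetherian _)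
  have hD' := (Ideal.pow_right_mono hrad D).trans hD
  let N : Submodule S P := Submodule.span S
    ((fun d : σ →₀ ℕ => φ (MvPolynomial.monomial d 1)) '' {d | d.degree < D})
  have hfg : N.FG := Submodule.fg_span ((Finsupp.finite_of_degree_lt D).image _)
  have hKN : ∀ (a : K) (p : P), p ∈ N → a • p ∈ N := fun a p hp => by
    have := N.smul_mem (algebraMap K S a) hp
    rwa [algebraMap_smul] at this
  have key : ∀ e : ℕ, ∀ f : MvPolynomial σ K, f.IsHomogeneous e → φ f ∈ N := by
    intro e
    induction e using Nat.strong_induction_on with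
    | _ e ih =>
      intro f hf
      by_cases he : e < D
      · rw [f.as_sum, map_sum]
        refine Submodule.sum_mem _ fun d hd => ?_
        have hdeg : d.degree = e := by
          have := hf (MvPolynomial.mem_support_iff.mp hd)
          rw [Finsupp.degree_eq_weight_one]; exact this
        have : MvPolynomial.monomial d (MvPolynomial.coeff d f)
            = MvPolynomial.coeff d f • MvPolynomial.monomial d (1 : K) := by
          simp [MvPolynomial.smul_monomial]
        rw [this, map_smul]
        apply hKN
        exact Submodule.subset_span ⟨d, by simp [hdeg, he], rfl⟩
      · have hfJ : f ∈ J := by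
          apply hD'
          rw [MvPolynomial.mem_pow_idealOfVars_iff]
          intro d hd
          have hdeg : d.degree = e := by
            have := hf (MvPolynomial.mem_support_iff.mp hd)
            rw [Finsupp.degree_eq_weight_one]; exact this
          omega
        obtain ⟨i, hi, q, hq, hiq⟩ := Submodule.mem_sup.mp hfJ
        obtain ⟨g, hg⟩ := (Ideal.mem_span_range_iff_exists_fun).mp hq
        rcases e with _ | e
        · have h1 : MvPolynomial.homogeneousComponent 0 f =
            MvPolynomial.homogeneousComponent 0 i := by
            rw [← hiq, ← hg]
            have : ∀ k, MvPolynomial.coeff 0 (L k) = 0 := fun k =>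
              (hL k).coeff_eq_zero (by simp)
            have h3 : ∀ k, MvPolynomial.coeff 0 (g k * L k) = 0 := fun k => by
              rw [← MvPolynomial.constantCoeff_eq, map_mul]
              have h4 : MvPolynomial.constantCoeff (L k) = 0 := this k
              rw [h4, mul_zero]
            simp [MvPolynomial.homogeneousComponent_zero, MvPolynomial.coeff_sum, h3]
          rw [← MvPolynomial.homogeneousComponent_eq_self hf, h1, hφ i hi]
          exact N.zero_mem
        · have h1 : f = MvPolynomial.homogeneousComponent (e + 1) i +
              ∑ k, MvPolynomial.homogeneousComponent e (g k) * L k := by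
            conv_lhs => rw [← MvPolynomial.homogeneousComponent_eq_self hf, ← hiq, ← hg]
            rw [map_add, map_sum]
            congr 1
            exact Finset.sum_congr rfl fun k _ => homComp_mul _ _ (hL k) _
          rw [h1, map_add, hφ i hi, zero_add, map_sum]
          refine Submodule.sum_mem _ fun k _ => ?_
          rw [map_mul, mul_comm]
          have hk : φ (L k) ∈ S := Algebra.subset_adjoin ⟨k, rfl⟩
          exact N.smul_mem ⟨_, hk⟩ (ih e (by omega) _
            (MvPolynomial.homogeneousComponent_isHomogeneous _ _))
  have key2 : ∀ f, φ f ∈ N := fun f => by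
    rw [← MvPolynomial.sum_homogeneousComponent f, map_sum]
    exact Submodule.sum_mem _ fun i _ => key i _
      (MvPolynomial.homogeneousComponent_isHomogeneous _ _)
  have hN0 : N ≠ ⊥ := by
    intro h
    have := key2 1
    rw [h, map_one] at this
    simp at this
  refine isIntegral_of_smul_mem_submodule N hN0 hfg (φ f) ?_
  intro m hm
  induction hm using Submodule.span_induction with
  | mem x hx =>
    obtain ⟨d, -, rfl⟩ := hx
    rw [smul_eq_mul, ← map_mul]
    exact key2 _
  | zero => simp
  | add x y _ _ hx hy => rw [smul_add]; exact N.add_mem hx hy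
  | smul a x _ hx => rw [smul_comm]; exact N.smul_mem a hx

section gen
open MvPolynomial

variable (K : Type*) [Field K] (a c : ℕ)

/-- index type of the parameters of the rank at most two matrices -/
abbrev PIdx (a c : ℕ) := (Fin a × Fin 2) ⊕ (Fin 2 × Fin c)

/-- the generic rank two matrix -/
noncomputable def genM (i : Fin a) (j : Fin c) : MvPolynomial (PIdx a c) K :=
  X (Sum.inl (i, 0)) * X (Sum.inr (0, j)) + X (Sum.inl (i, 1)) * X (Sum.inr (1, j))

/-- evaluation at a pair of matrices -/
noncomputable def evAt (A : Matrix (Fin a) (Fin 2) K) (B : Matrix (Fin 2) (Fin c) K) :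
    MvPolynomial (PIdx a c) K →ₐ[K] K :=
  aeval (Sum.elim (fun p => A p.1 p.2) (fun p => B p.1 p.2))

/-- pullback of polynomials to the parameter space -/
noncomputable def phiM : MvPolynomial (Fin a × Fin c) K →ₐ[K] MvPolynomial (PIdx a c) K :=
  aeval (fun p => genM K a c p.1 p.2)

/-- index set of the free entries -/
abbrev JIdx (a c : ℕ) := {p : Fin a × Fin c // p.1.val < 2 ∨ p.2.val < 2}

variable {K a c}

theorem evAt_genM (A : Matrix (Fin a) (Fin 2) K) (B : Matrix (Fin 2) (Fin c) K) (i : Fin a)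
    (j : Fin c) : evAt K a c A B (genM K a c i j) = (A * B) i j := by
  simp [evAt, genM, Matrix.mul_apply]

theorem evAt_phiM (A : Matrix (Fin a) (Fin 2) K) (B : Matrix (Fin 2) (Fin c) K)
    (f : MvPolynomial (Fin a × Fin c) K) :
    evAt K a c A B (phiM K a c f) = aeval (fun p : Fin a × Fin c => (A * B) p.1 p.2) f := by
  have : (evAt K a c A B).comp (phiM K a c)
      = aeval (fun p : Fin a × Fin c => (A * B) p.1 p.2) := by
    ext p
    simp [phiM, evAt_genM]
  rw [← this]; rfl

theorem eq_zero_of_evAt [Infinite K] (p : MvPolynomial (PIdx a c) K)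
    (h : ∀ A B, evAt K a c A B p = 0) : p = 0 := by
  apply MvPolynomial.funext
  intro x
  have := h (Matrix.of fun i k => x (Sum.inl (i, k))) (Matrix.of fun k j => x (Sum.inr (k, j)))
  rw [map_zero, ← this, evAt, ← MvPolynomial.coe_aeval_eq_eval]
  have h2 : (Sum.elim (fun p : Fin a × Fin 2 => x (Sum.inl (p.1, p.2)))
    (fun p : Fin 2 × Fin c => x (Sum.inr (p.1, p.2)))) = x := by
    ext p; cases p <;> rfl
  simp only [Matrix.of_apply]
  rw [h2]; rfl

theorem phiM_hom (f : MvPolynomial (Fin a × Fin c) K) (hf : phiM K a c f = 0) (i : ℕ) :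
    phiM K a c (homogeneousComponent i f) = 0 := by
  have hg : ∀ p : Fin a × Fin c, (genM K a c p.1 p.2).IsHomogeneous 2 := fun p =>
    ((isHomogeneous_X _ _).mul (isHomogeneous_X _ _)).add
      ((isHomogeneous_X _ _).mul (isHomogeneous_X _ _))
  have hh : ∀ j, (phiM K a c (homogeneousComponent j f)).IsHomogeneous (2 * j) := fun j =>
    (homogeneousComponent_isHomogeneous j f).aeval _ hg
  by_cases hi : i ∈ Finset.range (f.totalDegree + 1)
  · have h1 : homogeneousComponent (2 * i) (phiM K a c f) = 0 := by rw [hf, map_zero]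
    rw [← sum_homogeneousComponent f, map_sum, map_sum, Finset.sum_eq_single i] at h1
    · rwa [homogeneousComponent_eq_self (hh i)] at h1
    · intro j _ hj
      rw [homogeneousComponent_of_mem (hh j), if_neg (by omega)]
    · exact fun h => absurd hi h
  · rw [homogeneousComponent_eq_zero, map_zero]
    simpa using hi

theorem minors_phiM [Infinite K] (x : Fin a × Fin c → K)
    (hx : ∀ f, phiM K a c f = 0 → aeval x f = 0) :
    (Matrix.of fun i j => x (i, j)).rank ≤ 2 := by
  by_contra h
  obtain ⟨r, s, hrs⟩ := exists_minor _ (by omega : 3 ≤ (Matrix.of fun i j => x (i, j)).rank)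
  let f : MvPolynomial (Fin a × Fin c) K :=
    ((Matrix.of fun i j => X (R := K) (i, j)).submatrix r s).det
  have hev : ∀ y : Fin a × Fin c → K, aeval y f =
      ((Matrix.of fun i j => y (i, j)).submatrix r s).det := fun y => by
    simp only [f]
    rw [AlgHom.map_det]
    congr 1
    ext i j
    simp
  apply hrs
  rw [← hev]
  apply hx
  apply eq_zero_of_evAt
  intro A B
  rw [evAt_phiM, hev]
  exact det_zero A B r s

/-- the free entries -/
noncomputable def tJ (K : Type*) [Field K] (a c : ℕ) (p : JIdx a c) :
    MvPolynomial (PIdx a c) K := genM K a c p.1.1 p.1.2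

theorem delta_ne (ha : 2 ≤ a) (hc : 2 ≤ c) :
    genM K a c ⟨0, by omega⟩ ⟨0, by omega⟩ * genM K a c ⟨1, by omega⟩ ⟨1, by omega⟩
    - genM K a c ⟨0, by omega⟩ ⟨1, by omega⟩ * genM K a c ⟨1, by omega⟩ ⟨0, by omega⟩ ≠ 0 := by
  intro h
  have := congrArg (evAt K a c (Matrix.of fun i k => if i.val = k.val then 1 else 0)
    (Matrix.of fun k j => if j.val = k.val then 1 else 0)) h
  simp [evAt_genM, Matrix.mul_apply] at this

theorem tJ_indep [Infinite K] (ha : 2 ≤ a) (hc : 2 ≤ c) :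
    AlgebraicIndependent K (tJ K a c) := by
  rw [algebraicIndependent_iff]
  intro f hf
  let g : Fin 2 → Fin a := Fin.castLE ha
  let g' : Fin 2 → Fin c := Fin.castLE hc
  let rowI : Fin 2 → Fin c → JIdx a c := fun k j => ⟨(g k, j), Or.inl k.2⟩
  let colI : Fin a → Fin 2 → JIdx a c := fun i k => ⟨(i, g' k), Or.inr k.2⟩
  let Dp : MvPolynomial (JIdx a c) K := (Matrix.of fun k l => X (R := K) (rowI k (g' l))).det
  have hDp : ∀ y : JIdx a c → K, eval y Dp = (Matrix.of fun k l => y (rowI k (g' l))).det :=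
    fun y => by
      simp only [Dp]
      rw [RingHom.map_det]
      congr 1
      ext i j
      simp
  have hDp0 : Dp ≠ 0 := by
    intro h
    have h1 := hDp (fun p => if p.1.1.val = p.1.2.val then 1 else 0)
    rw [h, map_zero] at h1
    simp [Matrix.det_fin_two, rowI, g, g'] at h1
  have hmul : f * Dp = 0 := by
    apply MvPolynomial.funext
    intro y
    rw [map_mul, map_zero, hDp]
    set blk : Matrix (Fin 2) (Fin 2) K := Matrix.of fun k l => y (rowI k (g' l)) with hblk
    by_cases hd : blk.det = 0
    · rw [hd, mul_zero]
    let A : Matrix (Fin a) (Fin 2) K := Matrix.of fun i k => y (colI i k)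
    let R : Matrix (Fin 2) (Fin c) K := Matrix.of fun k j => y (rowI k j)
    have hu : IsUnit blk.det := isUnit_iff_ne_zero.mpr hd
    have hA : A.submatrix g id = blk := by ext k l; rfl
    have hR : R.submatrix id g' = blk := by ext k l; rfl
    have e1 : ∀ k j, (A * (blk⁻¹ * R)) (g k) j = R k j := by
      intro k j
      have : ((A.submatrix g id) * (blk⁻¹ * R)) k j = R k j := by
        rw [hA, Matrix.mul_nonsing_inv_cancel_left _ _ hu]
      rw [← this]; rfl
    have e2 : ∀ i l, (A * (blk⁻¹ * R)) i (g' l) = A i l := by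
      intro i l
      have : (A * (blk⁻¹ * (R.submatrix id g'))) i l = A i l := by
        rw [hR, Matrix.nonsing_inv_mul _ hu, Matrix.mul_one]
      rw [← this]; rfl
    have hev : ∀ p : JIdx a c, evAt K a c A (blk⁻¹ * R) (tJ K a c p) = y p := by
      rintro ⟨⟨i, j⟩, h⟩
      rw [tJ, evAt_genM]
      by_cases hi : i.val < 2
      · exact e1 ⟨i, hi⟩ j
      · have hj : j.val < 2 := h.resolve_left hi
        exact e2 i ⟨j, hj⟩
    have h2 : evAt K a c A (blk⁻¹ * R) (aeval (tJ K a c) f) = eval y f := by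
      rw [← AlgHom.comp_apply, MvPolynomial.comp_aeval]
      simp only [hev]
      rfl
    rw [hf, map_zero] at h2
    rw [← h2, zero_mul]
  exact (mul_eq_zero.mp hmul).resolve_right hDp0

theorem phiM_alg (ha : 2 ≤ a) (hc : 2 ≤ c) (f : MvPolynomial (Fin a × Fin c) K) :
    IsAlgebraic (Algebra.adjoin K (Set.range (tJ K a c))) (phiM K a c f) := by
  set S := Algebra.adjoin K (Set.range (tJ K a c))
  have hmem : ∀ (i : Fin a) (j : Fin c), (i.val < 2 ∨ j.val < 2) → genM K a c i j ∈ S :=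
    fun i j h => Algebra.subset_adjoin ⟨⟨(i, j), h⟩, rfl⟩
  induction f using MvPolynomial.induction_on with
  | C r =>
    have : phiM K a c (C r) = algebraMap S _ (algebraMap K S r) := by
      simp only [phiM, aeval_C]; rfl
    rw [this]
    exact isAlgebraic_algebraMap _
  | add p q hp hq => rw [map_add]; exact hp.add hq
  | mul_X p x hp =>
    rw [map_mul]
    refine hp.mul ?_
    obtain ⟨i, j⟩ := x
    have hX : phiM K a c (X (i, j)) = genM K a c i j := by simp [phiM]
    rw [hX]
    let r0 : Fin a := ⟨0, by omega⟩
    let r1 : Fin a := ⟨1, by omega⟩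
    let s0 : Fin c := ⟨0, by omega⟩
    let s1 : Fin c := ⟨1, by omega⟩
    let t := genM K a c
    have hR0 : ∀ j, t r0 j ∈ S := fun j => hmem _ _ (Or.inl (by simp [r0]))
    have hR1 : ∀ j, t r1 j ∈ S := fun j => hmem _ _ (Or.inl (by simp [r1]))
    have hS0 : ∀ i, t i s0 ∈ S := fun j => hmem _ _ (Or.inr (by simp [s0]))
    have hS1 : ∀ i, t i s1 ∈ S := fun j => hmem _ _ (Or.inr (by simp [s1]))
    let Δ := t r0 s0 * t r1 s1 - t r0 s1 * t r1 s0
    let q := t i s0 * (t r0 j * t r1 s1 - t r0 s1 * t r1 j)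
      + t i s1 * (t r0 s0 * t r1 j - t r1 s0 * t r0 j)
    have hΔ : Δ ∈ S := S.sub_mem (S.mul_mem (hR0 _) (hR1 _)) (S.mul_mem (hR0 _) (hR1 _))
    have hq : q ∈ S := S.add_mem
      (S.mul_mem (hS0 _) (S.sub_mem (S.mul_mem (hR0 _) (hR1 _)) (S.mul_mem (hR0 _) (hR1 _))))
      (S.mul_mem (hS1 _) (S.sub_mem (S.mul_mem (hR0 _) (hR1 _)) (S.mul_mem (hR1 _) (hR0 _))))
    have hrel : Δ * t i j - q = 0 := by
      simp only [Δ, q, t, genM]; ring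
    have hΔ0 : Δ ≠ 0 := delta_ne ha hc
    refine ⟨Polynomial.C ⟨Δ, hΔ⟩ * Polynomial.X - Polynomial.C ⟨q, hq⟩, ?_, ?_⟩
    · intro h
      have := congrArg (fun p => Polynomial.coeff p 1) h
      simp [Polynomial.coeff_C] at this
      exact hΔ0 (congrArg Subtype.val this)
    · simpa using hrel

/-- the linear form as a polynomial -/
noncomputable def linP {m : ℕ} (π : Matrix (Fin a) (Fin c) K →ₗ[K] (Fin m → K)) (k : Fin m) :
    MvPolynomial (Fin a × Fin c) K :=
  ∑ p : Fin a × Fin c, C (π (Matrix.single p.1 p.2 1) k) * X p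

theorem linP_hom {m : ℕ} (π : Matrix (Fin a) (Fin c) K →ₗ[K] (Fin m → K)) (k : Fin m) :
    (linP π k).IsHomogeneous 1 := by
  refine IsHomogeneous.sum _ _ _ fun p _ => ?_
  simpa using (isHomogeneous_C _ _).mul (isHomogeneous_X K p)

theorem linP_eval {m : ℕ} (π : Matrix (Fin a) (Fin c) K →ₗ[K] (Fin m → K)) (k : Fin m)
    (M : Matrix (Fin a) (Fin c) K) :
    aeval (fun p : Fin a × Fin c => M p.1 p.2) (linP π k) = π M k := by
  conv_rhs => rw [Matrix.matrix_eq_sum_single M]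
  simp only [linP, map_sum, map_mul, aeval_C, aeval_X, Finset.sum_apply,
    Fintype.sum_prod_type]
  refine Finset.sum_congr rfl fun i _ => Finset.sum_congr rfl fun j _ => ?_
  have : Matrix.single i j (M i j) = M i j • Matrix.single i j (1 : K) := by
    simp [Matrix.smul_single]
  rw [this, map_smul]
  simp [mul_comm]

theorem core1 [IsAlgClosed K] (ha : 2 ≤ a) (hc : 2 ≤ c) {m : ℕ}
    (π : Matrix (Fin a) (Fin c) K →ₗ[K] (Fin m → K))
    (h : ∀ M, π M = 0 → M ≠ 0 → 3 ≤ M.rank) : Fintype.card (JIdx a c) ≤ m := by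
  have : Infinite K := IsAlgClosed.instInfinite
  have := lemA (tJ K a c) (fun k => phiM K a c (linP π k)) (tJ_indep ha hc) (by
    intro p
    have hi := lemB (phiM K a c) phiM_hom (linP π) (linP_hom π) (by
      intro x hx hl
      have hr := minors_phiM x hx
      have h1 : π (Matrix.of fun i j => x (i, j)) = 0 := by
        ext k
        rw [← linP_eval]
        exact hl k
      by_contra hx0
      have := h _ h1 (by
        intro h0
        apply hx0
        ext ⟨i, j⟩
        exact congrFun (congrFun h0 i) j)
      omega) (X p.1)
    have hX : phiM K a c (X p.1) = tJ K a c p := by simp [phiM, tJ]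
    rw [hX] at hi
    exact hi.isAlgebraic)
  simpa using this

theorem core2 [Infinite K] (ha : 2 ≤ a) (hc : 2 ≤ c) {m : ℕ}
    (π : Matrix (Fin a) (Fin c) K →ₗ[K] (Fin m → K)) (hπ : Function.Surjective π)
    (h : Fintype.card (JIdx a c) < m) :
    ∃ v, ∀ M : Matrix (Fin a) (Fin c) K, M.rank ≤ 2 → π M ≠ π v := by
  have hni : ¬ AlgebraicIndependent K (fun k => phiM K a c (linP π k)) := by
    intro hi
    have := lemA _ (tJ K a c) hi (fun k => phiM_alg ha hc _)
    simp only [Fintype.card_fin] at this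
    omega
  rw [algebraicIndependent_iff] at hni
  push Not at hni
  obtain ⟨F, hF, hF0⟩ := hni
  have : ∃ w, eval w F ≠ 0 := by
    by_contra! hcon
    exact hF0 (MvPolynomial.funext fun w => by rw [hcon, map_zero])
  obtain ⟨w, hw⟩ := this
  obtain ⟨v, rfl⟩ := hπ w
  refine ⟨v, fun M hM heq => hw ?_⟩
  obtain ⟨A, B, rfl⟩ := exists_factor M hM
  have h2 : evAt K a c A B (aeval (fun k => phiM K a c (linP π k)) F) = eval (π (A * B)) F := by
    rw [← AlgHom.comp_apply, MvPolynomial.comp_aeval]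
    simp only [evAt_phiM, linP_eval]
    rfl
  rw [← heq, ← h2, hF, map_zero]

theorem card_JIdx (ha : 2 ≤ a) (hc : 2 ≤ c) :
    Fintype.card (JIdx a c) + (a - 2) * (c - 2) = a * c := by
  have h1 := Fintype.card_subtype_compl (fun p : Fin a × Fin c => p.1.val < 2 ∨ p.2.val < 2)
  have h2 := Fintype.card_subtype_le (fun p : Fin a × Fin c => p.1.val < 2 ∨ p.2.val < 2)
  have e : {p : Fin a × Fin c // ¬ (p.1.val < 2 ∨ p.2.val < 2)} ≃ Fin (a - 2) × Fin (c - 2) :=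
    { toFun := fun p => (⟨p.1.1.val - 2, by have := p.2; omega⟩, ⟨p.1.2.val - 2, by
        have := p.2; omega⟩)
      invFun := fun q => ⟨(⟨q.1.val + 2, by omega⟩, ⟨q.2.val + 2, by omega⟩), by simp⟩
      left_inv := by
        rintro ⟨⟨i, j⟩, h⟩
        simp only [not_or, not_lt] at h
        ext <;> simp <;> omega
      right_inv := by
        rintro ⟨i, j⟩
        simp }
  rw [Fintype.card_congr e] at h1
  simp only [Fintype.card_prod, Fintype.card_fin] at h1 h2
  rw [h1]
  exact Nat.add_sub_cancel' h2

theorem exists_proj (H : Submodule K (Matrix (Fin a) (Fin c) K)) :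
    ∃ (m : ℕ) (π : Matrix (Fin a) (Fin c) K →ₗ[K] (Fin m → K)), Function.Surjective π ∧
      (∀ M, π M = 0 ↔ M ∈ H) ∧ m + Module.finrank K H = a * c := by
  let e := (Module.finBasis K (Matrix (Fin a) (Fin c) K ⧸ H)).equivFun
  refine ⟨_, e.toLinearMap ∘ₗ H.mkQ, e.surjective.comp H.mkQ_surjective, fun M => ?_, ?_⟩
  · simp
  · rw [Submodule.finrank_quotient_add_finrank, Module.finrank_matrix]; simp

theorem main_aux [IsAlgClosed K] (ha : 2 ≤ a) (hc : 2 ≤ c) (d : ℕ) :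
    ∀ (H : Submodule K (Matrix (Fin a) (Fin c) K)),
    (∀ M ∈ H, M ≠ 0 → 3 ≤ M.rank) → (a - 2) * (c - 2) - Module.finrank K H = d →
    ∃ H' : Submodule K (Matrix (Fin a) (Fin c) K), H ≤ H' ∧
      Module.finrank K H' = (a - 2) * (c - 2) ∧ ∀ M ∈ H', M ≠ 0 → 3 ≤ M.rank := by
  have : Infinite K := IsAlgClosed.instInfinite
  induction d using Nat.strong_induction_on with
  | _ d ih =>
    intro H hH hd
    obtain ⟨m, π, hπ, hker, hdim⟩ := exists_proj H
    have hcard := card_JIdx ha hc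
    have h1 := core1 ha hc π (fun M hM => hH M ((hker M).mp hM))
    by_cases heq : Module.finrank K H = (a - 2) * (c - 2)
    · exact ⟨H, le_rfl, heq, hH⟩
    obtain ⟨v, hv⟩ := core2 ha hc π hπ (by omega)
    have hvH : v ∉ H := fun hvH => hv 0 (by simp) (by rw [map_zero, (hker v).mpr hvH])
    have hlt : H < H ⊔ Submodule.span K {v} := by
      refine lt_of_le_of_ne le_sup_left fun h => hvH ?_
      rw [h]
      exact Submodule.mem_sup_right (Submodule.mem_span_singleton_self v)
    have hfr := Submodule.finrank_lt_finrank_of_lt hlt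
    obtain ⟨H', hle, hf, hr⟩ := ih _ (by omega) (H ⊔ Submodule.span K {v}) (by
      intro M hM hM0
      obtain ⟨x, hx, y, hy, rfl⟩ := Submodule.mem_sup.mp hM
      obtain ⟨t, rfl⟩ := Submodule.mem_span_singleton.mp hy
      by_cases ht : t = 0
      · subst ht
        rw [zero_smul, add_zero] at hM0 ⊢
        exact hH x hx hM0
      by_contra hcon
      obtain ⟨A, B, hAB⟩ := exists_factor (x + t • v) (by omega)
      refine hv ((t⁻¹ • A) * B) ?_ ?_
      · exact (Matrix.rank_mul_le_left _ _).trans (Matrix.rank_le_width _)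
      · rw [Matrix.smul_mul, ← hAB, map_smul, map_add, (hker x).mpr hx, zero_add, map_smul,
          smul_smul, inv_mul_cancel₀ ht, one_smul]) rfl
    exact ⟨H', hlt.le.trans hle, hf, hr⟩

end gen

/-- **Theorem 14 (in the Drézet correspondence).** Every linear subspace `H` of the space
of `(n+1) × c` matrices all of whose nonzero elements have rank at least 3 extends to a
subspace `H′ ⊇ H` of the maximal dimension `(n−1)(c−2) = (n+1)c − 2c − 2n + 2` all of
whose nonzero elements still have rank at least 3.  (Equivalently: every 1-type uniform
Steiner bundle `E` on Pⁿ with `c₁ = −c` fits in an exact sequence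
`0 → F → E → O^α → 0` with `F` 1-type uniform of the minimal rank `c + 2(n−1)`.) -/
theorem stmt7 {K : Type*} [Field K] [IsAlgClosed K] [CharZero K]
    (n c : ℕ) (hn : 2 ≤ n) (hc : 2 ≤ c)
    (H : Submodule K (Matrix (Fin (n + 1)) (Fin c) K))
    (hH : ∀ M ∈ H, M ≠ 0 → 3 ≤ M.rank) :
    ∃ H' : Submodule K (Matrix (Fin (n + 1)) (Fin c) K),
      H ≤ H' ∧
      Module.finrank K H' = (n - 1) * (c - 2) ∧
      ∀ M ∈ H', M ≠ 0 → 3 ≤ M.rank := by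
  have h := main_aux (a := n + 1) (by omega) hc _ H hH rfl
  have e : n + 1 - 2 = n - 1 := by omega
  rwa [e] at h
end

section
/- Let K be an algebraically closed field of characteristic 0, c ≥ 2 an integer, and A a c×(2c+2) matrix of linear forms in 3 variables over K such that rank A(p) = c for every p ∈ K³ \ {0} and such that for every 2-dimensional subspace W ⊆ K³ the space {v ∈ K^{2c+2} : A(w)·v = 0 for all w ∈ W} has dimension 2. Let S = K[x₀,x₁,x₂], let S_d be its degree-d homogeneous component (with S_{−1} = 0), and for each integer d ≥ −1 let μ_d : (S_d)^{2c+2} → (S_{d+1})^c be the K-linear map v ↦ A·v. Then for every integer t ≥ −1, dim coker μ_{t+1} ≤ max(0, dim coker μ_t − 2). (This is Lemma 17: for a 1-type uniform Steiner bundle E of minimal rank c+2 on P² with c₁ = −c, one has h¹(E(t+1)) ≤ max(0, h¹(E(t)) − 2) for every t ≥ −1.) -/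
open Matrix MvPolynomial

/-- The matrix of linear forms `A` as a matrix with entries in `S = K[x₀,x₁,x₂]`. -/
noncomputable def polyMat {K : Type*} [CommRing K] {c x : ℕ}
    (A : Fin 3 → Matrix (Fin c) (Fin x) K) :
    Matrix (Fin c) (Fin x) (MvPolynomial (Fin 3) K) :=
  fun i j => ∑ k, MvPolynomial.C (A k i j) * MvPolynomial.X k

/-- `(S_d)^x`, the space of `x`-tuples of homogeneous polynomials of degree `d` in
`S = K[x₀,x₁,x₂]`, with the convention `S_d = 0` for `d < 0`. -/
noncomputable def homogPi (K : Type*) [Field K] (x : ℕ) (d : ℤ) :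
    Submodule K (Fin x → MvPolynomial (Fin 3) K) :=
  if 0 ≤ d then
    Submodule.pi Set.univ (fun _ => homogeneousSubmodule (Fin 3) K d.toNat)
  else ⊥

/-- `dim coker μ_d`, where `μ_d : (S_d)^x → (S_{d+1})^c` is multiplication by the matrix
of linear forms `A` ; equivalently `h¹(E(d))` for the associated Steiner bundle `E`. -/
noncomputable def cokerDim {K : Type*} [Field K] {c x : ℕ}
    (A : Fin 3 → Matrix (Fin c) (Fin x) K) (d : ℤ) : ℕ :=
  Module.finrank K (homogPi K c (d + 1)) -
    Module.finrank K
      (Submodule.map (LinearMap.restrictScalars K (polyMat A).mulVecLin) (homogPi K x d))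


namespace Stmt10

lemma hc_X_mul {K : Type*} [Field K] (d : ℕ) (k : Fin 3) (g : MvPolynomial (Fin 3) K) :
    homogeneousComponent (d + 1) (X k * g) = X k * homogeneousComponent d g := by
  ext m
  rw [coeff_homogeneousComponent, coeff_X_mul', coeff_X_mul', coeff_homogeneousComponent]
  by_cases hk : k ∈ m.support
  · have h1 : Finsupp.single k 1 ≤ m := by
      rw [Finsupp.single_le_iff]
      have := Finsupp.mem_support_iff.1 hk
      omega
    have h2 : m.degree = (m - Finsupp.single k 1).degree + 1 := by
      conv_lhs => rw [← tsub_add_cancel_of_le h1]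
      rw [map_add, Finsupp.degree_single]
    simp only [hk, if_true, h2, add_left_inj]
  · simp [hk]

lemma polyMat_mulVec_apply {K : Type*} [Field K] {c x : ℕ}
    (A : Fin 3 → Matrix (Fin c) (Fin x) K) (v : Fin x → MvPolynomial (Fin 3) K) (i : Fin c) :
    (polyMat A *ᵥ v) i = ∑ j, ∑ k, C (A k i j) * (X k * v j) := by
  simp only [Matrix.mulVec, dotProduct, polyMat, Finset.sum_mul, mul_assoc]

lemma hc_mulVec {K : Type*} [Field K] {c x : ℕ}
    (A : Fin 3 → Matrix (Fin c) (Fin x) K) (v : Fin x → MvPolynomial (Fin 3) K) (d : ℕ) :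
    (polyMat A *ᵥ fun j => homogeneousComponent d (v j)) =
      fun i => homogeneousComponent (d + 1) ((polyMat A *ᵥ v) i) := by
  ext1 i
  simp only [polyMat_mulVec_apply, map_sum, homogeneousComponent_C_mul, hc_X_mul]

lemma polyMat_isHomogeneous {K : Type*} [Field K] {c x : ℕ}
    (A : Fin 3 → Matrix (Fin c) (Fin x) K) (i j) : (polyMat A i j).IsHomogeneous 1 :=
  IsHomogeneous.sum _ _ _ fun k _ => isHomogeneous_C_mul_X _ _

lemma mulVec_isHomogeneous {K : Type*} [Field K] {c x : ℕ}
    (A : Fin 3 → Matrix (Fin c) (Fin x) K) (v : Fin x → MvPolynomial (Fin 3) K) (d : ℕ)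
    (hv : ∀ j, (v j).IsHomogeneous d) (i : Fin c) :
    ((polyMat A *ᵥ v) i).IsHomogeneous (d + 1) := by
  refine IsHomogeneous.sum _ _ _ fun k _ => ?_
  rw [add_comm]
  exact (polyMat_isHomogeneous A i k).mul (hv k)

lemma eval_polyMat {K : Type*} [Field K] {c x : ℕ}
    (A : Fin 3 → Matrix (Fin c) (Fin x) K) (p : Fin 3 → K) :
    (polyMat A).map (eval p) = evalMat A p := by
  ext i j
  simp [polyMat, evalMat, Matrix.sum_apply, mul_comm]

/-- signed maximal minors of a `b × (b+1)` matrix -/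
def sminor {R : Type*} [CommRing R] {b : ℕ} (N : Matrix (Fin b) (Fin (b + 1)) R)
    (i : Fin (b + 1)) : R := (-1) ^ (i : ℕ) * (N.submatrix id i.succAbove).det

lemma det_cons {R : Type*} [CommRing R] {b : ℕ} (N : Matrix (Fin b) (Fin (b + 1)) R)
    (w : Fin (b + 1) → R) :
    (Matrix.of (Fin.cons w N) : Matrix (Fin (b + 1)) (Fin (b + 1)) R).det =
      ∑ i, w i * sminor N i := by
  rw [Matrix.det_succ_row_zero]
  refine Finset.sum_congr rfl fun i _ => ?_
  have : (Matrix.of (Fin.cons w N) : Matrix (Fin (b + 1)) (Fin (b + 1)) R).submatrix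
      Fin.succ i.succAbove = N.submatrix id i.succAbove := by
    ext r s; rfl
  rw [this]
  have h0 : (Matrix.of (Fin.cons w N) : Matrix (Fin (b + 1)) (Fin (b + 1)) R) 0 i = w i := rfl
  rw [h0, sminor]
  ring

lemma mulVec_sminor {R : Type*} [CommRing R] {b : ℕ} (N : Matrix (Fin b) (Fin (b + 1)) R) :
    N *ᵥ sminor N = 0 := by
  ext r
  have h := det_cons N (N r)
  rw [Matrix.det_zero_of_row_eq (i := 0) (j := r.succ) (Fin.succ_ne_zero r).symm
    rfl] at h
  simpa [Matrix.mulVec, dotProduct] using h.symm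

lemma exists_sminor_ne_zero {K : Type*} [Field K] {b : ℕ} (N : Matrix (Fin b) (Fin (b + 1)) K)
    (h : N.rank = b) : ∃ i, sminor N i ≠ 0 := by
  have hli : LinearIndependent K N.row := by
    rw [linearIndependent_iff_card_eq_finrank_span, Fintype.card_fin, Set.finrank,
      ← Matrix.rank_eq_finrank_span_row, h]
  obtain ⟨w, hw⟩ : ∃ w, w ∉ Submodule.span K (Set.range N.row) := by
    by_contra! hcon
    have htop : Submodule.span K (Set.range N.row) = ⊤ := by
      ext; simp [hcon]
    have h2 := Matrix.rank_eq_finrank_span_row N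
    rw [h, htop, finrank_top, Module.finrank_fin_fun] at h2
    omega
  have h3 : LinearIndependent K (Fin.cons w N.row : Fin (b + 1) → (Fin (b + 1) → K)) :=
    linearIndependent_finCons.2 ⟨hli, hw⟩
  have h4 : (Matrix.of (Fin.cons w N) : Matrix (Fin (b + 1)) (Fin (b + 1)) K).det ≠ 0 := by
    have : IsUnit (Matrix.of (Fin.cons w N) : Matrix (Fin (b + 1)) (Fin (b + 1)) K) :=
      Matrix.linearIndependent_rows_iff_isUnit.1 h3
    exact ((Matrix.isUnit_iff_isUnit_det _).1 this).ne_zero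
  by_contra! hcon
  apply h4
  rw [det_cons]
  simp [hcon]

lemma sminor_map {R R' : Type*} [CommRing R] [CommRing R'] (f : R →+* R') {b : ℕ}
    (N : Matrix (Fin b) (Fin (b + 1)) R) (i) : f (sminor N i) = sminor (N.map f) i := by
  simp only [sminor, map_mul, map_pow, map_neg, map_one, RingHom.map_det]
  rfl

lemma sminor_isHomogeneous {K : Type*} [Field K] {b : ℕ}
    (B : Fin 3 → Matrix (Fin b) (Fin (b + 1)) K) (i) :
    (sminor (polyMat B) i).IsHomogeneous b := by
  have h : ((polyMat B).submatrix id i.succAbove).det.IsHomogeneous b := by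
    rw [Matrix.det_apply]
    refine IsHomogeneous.sum _ _ _ fun s _ => ?_
    have h1 : (∏ r, (polyMat B).submatrix id i.succAbove (s r) r).IsHomogeneous b := by
      have := IsHomogeneous.prod Finset.univ
        (fun r => (polyMat B).submatrix id i.succAbove (s r) r) (fun _ => 1)
        (fun r _ => polyMat_isHomogeneous B _ _)
      simpa using this
    rcases Int.units_eq_one_or (Equiv.Perm.sign s) with h2 | h2
    · simpa [h2] using h1
    · simpa [h2] using h1.neg
  have h0 : ((-1 : MvPolynomial (Fin 3) K) ^ (i : ℕ)).IsHomogeneous 0 := by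
    simpa using ((isHomogeneous_one (Fin 3) K).neg).pow (i : ℕ)
  simpa [sminor] using h0.mul h

/-- a polynomial in the ideal of the minors, times a constant vector, is in the image -/
lemma exists_preimage {R : Type*} [CommRing R] {b : ℕ} (N : Matrix (Fin b) (Fin (b + 1)) R)
    (f : R) (hf : f ∈ Ideal.span (Set.range (sminor N))) (u : Fin b → R) :
    ∃ v, N *ᵥ v = f • u := by
  have key : Ideal.span (Set.range (sminor N)) ≤
      (LinearMap.range N.mulVecLin).comap (LinearMap.toSpanSingleton R _ u) := by
    rw [Ideal.span_le]
    rintro _ ⟨i, rfl⟩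
    set T := N.submatrix id i.succAbove with hT
    -- extend a vector by zero at `i`
    let g : Fin b → R := T.adjugate *ᵥ u
    refine ⟨i.insertNth 0 ((-1 : R) ^ (i : ℕ) • g), ?_⟩
    have h1 : N *ᵥ (i.insertNth 0 ((-1 : R) ^ (i : ℕ) • g)) = T *ᵥ ((-1 : R) ^ (i : ℕ) • g) := by
      ext r
      simp [Matrix.mulVec, dotProduct, Fin.sum_univ_succAbove _ i, T]
    simp only [Matrix.mulVecLin_apply, LinearMap.toSpanSingleton_apply]
    rw [h1, Matrix.mulVec_smul, Matrix.mulVec_mulVec, Matrix.mul_adjugate, Matrix.smul_mulVec,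
      Matrix.one_mulVec, smul_smul]
    rfl
  obtain ⟨v, hv⟩ := key hf
  exact ⟨v, by simpa using hv⟩

lemma finrank_homog (K : Type*) [Field K] (d : ℕ) :
    Module.finrank K (homogeneousSubmodule (Fin 3) K d) = (d + 2).choose 2 := by
  rw [homogeneousSubmodule_eq_finsupp_supported]
  rw [(AddMonoidAlgebra.supportedEquivFinsupp (R := K) (S := K)
    {m : Fin 3 →₀ ℕ | m.degree = d}).finrank_eq]
  have hset : {m : Fin 3 →₀ ℕ | m.degree = d} =
      ((Finset.univ : Finset (Fin 3)).finsuppAntidiag d : Set (Fin 3 →₀ ℕ)) := by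
    ext m
    simp [Finset.mem_finsuppAntidiag, Finsupp.degree_eq_sum]
  rw [hset, Module.finrank_finsupp_self]
  simp only [SetLike.coe_sort_coe, Fintype.card_coe]
  rw [Finset.card_finsuppAntidiag_nat_eq_choose, Finset.card_univ, Fintype.card_fin,
    show 3 + d - 1 = d + 2 by omega, ← Nat.choose_symm_add]

instance homog_finite (K : Type*) [Field K] (d : ℕ) :
    Module.Finite K (homogeneousSubmodule (Fin 3) K d) :=
  Module.Finite.iff_fg.2 (homogeneousSubmodule_fg _ _ d)

end Stmt10

namespace Stmt10

lemma homog_mem_pow {K : Type*} [Field K] (d : ℕ) (f : MvPolynomial (Fin 3) K)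
    (hf : f.IsHomogeneous d) :
    f ∈ (Ideal.span (Set.range (X : Fin 3 → MvPolynomial (Fin 3) K))) ^ d := by
  rw [Ideal.mem_span_pow_iff_exists_isHomogeneous]
  refine ⟨MvPolynomial.map C f, hf.map _, ?_⟩
  rw [eval_map]
  exact eval₂_eta f

/-- There is no net of `b × (b+1)` matrices of constant rank `b ≥ 1`. -/
lemma no_net {K : Type*} [Field K] [IsAlgClosed K] [CharZero K] (b : ℕ) (hb : 1 ≤ b)
    (B : Fin 3 → Matrix (Fin b) (Fin (b + 1)) K)
    (hB : ∀ p : Fin 3 → K, p ≠ 0 → (evalMat B p).rank = b) : False := by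
  classical
  set J : Ideal (MvPolynomial (Fin 3) K) := Ideal.span (Set.range (sminor (polyMat B))) with hJ
  have hmin : ∀ p : Fin 3 → K, p ≠ 0 → ∃ i, eval p (sminor (polyMat B) i) ≠ 0 := by
    intro p hp
    obtain ⟨i, hi⟩ := exists_sminor_ne_zero _ (hB p hp)
    refine ⟨i, ?_⟩
    rw [sminor_map, eval_polyMat]
    exact hi
  have hrad : Ideal.span (Set.range (X : Fin 3 → MvPolynomial (Fin 3) K)) ≤ J.radical := by
    rw [← vanishingIdeal_zeroLocus_eq_radical (K := K), Ideal.span_le]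
    rintro _ ⟨k, rfl⟩
    simp only [SetLike.mem_coe, mem_vanishingIdeal_iff, mem_zeroLocus_iff]
    intro p hp
    have hp0 : p = 0 := by
      by_contra hne
      obtain ⟨i, hi⟩ := hmin p hne
      apply hi
      have := hp _ (Ideal.subset_span ⟨i, rfl⟩)
      simpa [aeval_eq_eval] using this
    simp [hp0]
  obtain ⟨N, hN⟩ := Ideal.exists_pow_le_of_le_radical_of_fg hrad
    (Submodule.fg_span (Set.finite_range _))
  set d := b + N with hd
  -- the multiplication map in degree `d`
  let H := fun e : ℕ => homogeneousSubmodule (Fin 3) K e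
  let μ : (Fin (b + 1) → H d) →ₗ[K] (Fin b → H (d + 1)) :=
    { toFun := fun v i => ⟨(polyMat B *ᵥ fun j => (v j : MvPolynomial (Fin 3) K)) i,
        mulVec_isHomogeneous B _ d (fun j => (v j).2) i⟩
      map_add' := by
        intro v w
        ext1 i
        apply Subtype.ext
        simp only [polyMat_mulVec_apply, Pi.add_apply, Submodule.coe_add, mul_add,
          Finset.sum_add_distrib]
      map_smul' := by
        intro a v
        ext1 i
        apply Subtype.ext
        simp only [polyMat_mulVec_apply, Pi.smul_apply, Submodule.coe_smul, RingHom.id_apply,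
          Finset.smul_sum, mul_smul_comm] }
  have hsurj : Function.Surjective μ := by
    intro h
    have h1 : ∀ i, ∃ v, polyMat B *ᵥ v =
        (h i : MvPolynomial (Fin 3) K) • (Pi.single i 1 : Fin b → MvPolynomial (Fin 3) K) := by
      intro i
      refine exists_preimage _ _ (hN (Ideal.pow_le_pow_right ?_ (homog_mem_pow _ _ (h i).2))) _
      omega
    choose v hv using h1
    refine ⟨fun j => ⟨homogeneousComponent d ((∑ i, v i) j), homogeneousComponent_isHomogeneous _ _⟩,
      ?_⟩
    ext1 i
    apply Subtype.ext
    have h2 : polyMat B *ᵥ (∑ i, v i) = fun i => (h i : MvPolynomial (Fin 3) K) := by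
      rw [Matrix.mulVec_sum]
      simp only [hv]
      ext1 i
      simp [Finset.sum_apply, Pi.single_apply]
    change (polyMat B *ᵥ fun j => homogeneousComponent d ((∑ i, v i) j)) i = _
    rw [hc_mulVec, h2]
    exact homogeneousComponent_eq_self (h i).2
  let ι : H N →ₗ[K] LinearMap.ker μ :=
    { toFun := fun f => ⟨fun j => ⟨sminor (polyMat B) j * f,
          (sminor_isHomogeneous B j).mul f.2⟩, by
            rw [LinearMap.mem_ker]
            ext1 i
            apply Subtype.ext
            have := congrFun (mulVec_sminor (polyMat B)) i
            change (polyMat B *ᵥ fun j => sminor (polyMat B) j * (f : MvPolynomial (Fin 3) K)) i = 0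
            have h3 : (fun j => sminor (polyMat B) j * (f : MvPolynomial (Fin 3) K)) =
              (f : MvPolynomial (Fin 3) K) • sminor (polyMat B) := by
              ext1 j; simp [mul_comm]
            rw [h3, Matrix.mulVec_smul, mulVec_sminor]
            simp⟩
      map_add' := by
        intro f g
        apply Subtype.ext
        ext1 j
        apply Subtype.ext
        simp [mul_add]
      map_smul' := by
        intro a f
        apply Subtype.ext
        ext1 j
        apply Subtype.ext
        simp }
  have hinj : Function.Injective ι := by
    obtain ⟨i, hi⟩ := hmin (Pi.single 0 1) (by simp)
    have hne : sminor (polyMat B) i ≠ 0 := by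
      intro h0; rw [h0] at hi; simp at hi
    intro f g hfg
    have := congrArg (fun z : LinearMap.ker μ => ((z.1 i : H d) : MvPolynomial (Fin 3) K)) hfg
    exact Subtype.ext (mul_left_cancel₀ hne this)
  have e1 := LinearMap.finrank_range_add_finrank_ker μ
  rw [LinearMap.range_eq_top.2 hsurj, finrank_top] at e1
  have e2 := LinearMap.finrank_le_finrank_of_injective hinj
  simp only [H, Module.finrank_pi_fintype, finrank_homog, Finset.sum_const, Finset.card_univ,
    Fintype.card_fin, smul_eq_mul] at e1 e2
  have e3 : b * (d + 1 + 2).choose 2 + (N + 2).choose 2 ≤ (b + 1) * (d + 2).choose 2 := by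
    omega
  have e4 : (b : ℚ) * ((d + 1 + 2).choose 2 : ℕ) + ((N + 2).choose 2 : ℕ) ≤
      (b + 1) * ((d + 2).choose 2 : ℕ) := by exact_mod_cast e3
  rw [Nat.cast_choose_two, Nat.cast_choose_two, Nat.cast_choose_two, hd] at e4
  push_cast at e4
  have hb' : (1 : ℚ) ≤ b := by exact_mod_cast hb
  nlinarith

lemma hopf {K : Type*} [Field K] [IsAlgClosed K] [CharZero K]
    {P Q : Type*} [AddCommGroup P] [Module K P] [Module.Finite K P]
    [AddCommGroup Q] [Module K Q] [Module.Finite K Q]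
    (φ : Fin 3 → (P →ₗ[K] Q))
    (hs : ∀ p : Fin 3 → K, p ≠ 0 → Function.Surjective (∑ k, p k • φ k : P →ₗ[K] Q)) :
    Module.finrank K Q ≤ Module.finrank K P - 2 := by
  by_contra hcon
  set b := Module.finrank K Q with hb
  set a := Module.finrank K P with ha
  obtain ⟨π, hπ⟩ : ∃ π : (Fin (b + 1) → K) →ₗ[K] P, Function.Surjective π := by
    let e := Module.finBasis K P
    have hab : a ≤ b + 1 := by omega
    let g := LinearMap.funLeft K K (Fin.castLE hab)
    refine ⟨e.equivFun.symm.toLinearMap ∘ₗ g, ?_⟩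
    rw [LinearMap.coe_comp]
    exact e.equivFun.symm.surjective.comp
      (LinearMap.funLeft_surjective_of_injective K K _ (Fin.castLE_injective hab))
  let eq := (Module.finBasis K Q).equivFun
  refine no_net b (by omega)
    (fun k => LinearMap.toMatrix' (eq.toLinearMap ∘ₗ φ k ∘ₗ π)) fun p hp => ?_
  have h1 : evalMat (fun k => LinearMap.toMatrix' (eq.toLinearMap ∘ₗ φ k ∘ₗ π)) p =
      LinearMap.toMatrix' (eq.toLinearMap ∘ₗ (∑ k, p k • φ k) ∘ₗ π) := by
    rw [evalMat]
    simp only [← map_smul, ← map_sum]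
    congr 1
    ext1 v
    ext1
    simp [map_sum]
  rw [h1, Matrix.rank, Matrix.mulVecLin, ]
  have h2 : LinearMap.range (Matrix.mulVecLin (LinearMap.toMatrix'
      (eq.toLinearMap ∘ₗ (∑ k, p k • φ k) ∘ₗ π))) = ⊤ := by
    rw [← Matrix.toLin'_apply', Matrix.toLin'_toMatrix', LinearMap.range_eq_top]
    simp only [LinearMap.coe_comp]
    exact eq.surjective.comp ((hs p hp).comp hπ)
  change Module.finrank K (LinearMap.range (Matrix.mulVecLin (LinearMap.toMatrix'
      (eq.toLinearMap ∘ₗ (∑ k, p k • φ k) ∘ₗ π)))) = b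
  rw [h2, finrank_top, Module.finrank_fin_fun]

lemma hopf_sub {K : Type*} [Field K] [IsAlgClosed K] [CharZero K]
    {F G : Type*} [AddCommGroup F] [Module K F] [AddCommGroup G] [Module K G]
    (H N : Submodule K F) (H' N' : Submodule K G) [Module.Finite K H] [Module.Finite K H']
    (hN : N ≤ H) (hN' : N' ≤ H') (m : Fin 3 → (F →ₗ[K] G))
    (hmH : ∀ k, ∀ h ∈ H, m k h ∈ H') (hmN : ∀ k, ∀ h ∈ N, m k h ∈ N')
    (hs : ∀ p : Fin 3 → K, p ≠ 0 → ∀ h ∈ H', ∃ f ∈ H, h - ∑ k, p k • m k f ∈ N') :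
    Module.finrank K H' - Module.finrank K N' ≤
      Module.finrank K H - Module.finrank K N - 2 := by
  have e1 := (N.submoduleOf H).finrank_quotient_add_finrank
  have e2 := (N'.submoduleOf H').finrank_quotient_add_finrank
  rw [(Submodule.submoduleOfEquivOfLe hN).finrank_eq] at e1
  rw [(Submodule.submoduleOfEquivOfLe hN').finrank_eq] at e2
  have h := hopf (K := K) (P := H ⧸ N.submoduleOf H) (Q := H' ⧸ N'.submoduleOf H')
    (fun k => Submodule.mapQ _ _ ((m k).restrict (hmH k)) (by
      intro x hx
      rw [Submodule.submoduleOf, Submodule.mem_comap] at hx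
      rw [Submodule.mem_comap, Submodule.submoduleOf, Submodule.mem_comap]
      exact hmN k x hx)) (by
      intro p hp y
      obtain ⟨h, rfl⟩ := Submodule.Quotient.mk_surjective _ y
      obtain ⟨f, hf, hfh⟩ := hs p hp h h.2
      refine ⟨Submodule.Quotient.mk ⟨f, hf⟩, ?_⟩
      simp only [LinearMap.sum_apply, LinearMap.smul_apply, Submodule.mapQ_apply,
        ← Submodule.Quotient.mk_smul]
      simp only [← Submodule.mkQ_apply, ← map_sum]
      symm
      rw [← sub_eq_zero, ← map_sub, Submodule.mkQ_apply, Submodule.Quotient.mk_eq_zero,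
        Submodule.submoduleOf, Submodule.mem_comap]
      simpa using hfh)
  omega

end Stmt10

namespace Stmt10

/-- degree-one step: modulo a linear form, every vector of linear forms is hit by constants -/
lemma lin_step {K : Type*} [Field K] (c : ℕ)
    (A : Fin 3 → Matrix (Fin c) (Fin (2 * c + 2)) K)
    (huniform : ∀ W : Submodule K (Fin 3 → K), Module.finrank K W = 2 →
      Module.finrank K
        (⨅ w ∈ W, LinearMap.ker (evalMat A w).mulVecLin :
          Submodule K (Fin (2 * c + 2) → K)) = 2)
    (p : Fin 3 → K) (hp : p ≠ 0) (e : Fin 3 → Fin c → K) :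
    ∃ (v : Fin (2 * c + 2) → K) (f : Fin c → K), ∀ k, e k = A k *ᵥ v + p k • f := by
  classical
  obtain ⟨k0, hk0⟩ := Function.ne_iff.1 hp
  simp only [Pi.zero_apply] at hk0
  let L : (Fin 3 → K) →ₗ[K] K := Fintype.linearCombination K p
  have hL : ∀ w, L w = ∑ k, w k * p k := fun w => by
    simp [L, Fintype.linearCombination_apply]
  have hLs : Function.Surjective L := by
    intro y
    refine ⟨Pi.single k0 (y / p k0), ?_⟩
    simp [hL, Pi.single_apply, hk0]
  set W := LinearMap.ker L with hW
  have hW2 : Module.finrank K W = 2 := by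
    have := LinearMap.finrank_range_add_finrank_ker L
    rw [LinearMap.range_eq_top.2 hLs, finrank_top, Module.finrank_self,
      Module.finrank_fin_fun, ← hW] at this
    omega
  have hu := huniform W hW2
  let ev : (Fin 3 → Fin c → K) →ₗ[K] (W →ₗ[K] (Fin c → K)) :=
    { toFun := fun e =>
        { toFun := fun w => ∑ k, (w : Fin 3 → K) k • e k
          map_add' := by
            intro a b; simp [add_smul, Finset.sum_add_distrib]
          map_smul' := by
            intro a b; simp [Finset.smul_sum, smul_smul] }
      map_add' := by
        intro a b; ext1 w; simp [Finset.sum_add_distrib]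
      map_smul' := by
        intro a b; ext1 w; simp [Finset.smul_sum, smul_comm a] }
  let T0 : (Fin (2 * c + 2) → K) →ₗ[K] (Fin 3 → Fin c → K) :=
    LinearMap.pi fun k => (A k).mulVecLin
  have hT : ∀ v (w : W), ev (T0 v) w = evalMat A w *ᵥ v := by
    intro v w
    simp [ev, T0, evalMat, Matrix.sum_mulVec, Matrix.smul_mulVec]
  have hker : LinearMap.ker (ev ∘ₗ T0) = ⨅ w ∈ W, LinearMap.ker (evalMat A w).mulVecLin := by
    ext v
    simp only [LinearMap.mem_ker, Submodule.mem_iInf, LinearMap.comp_apply, Matrix.mulVecLin_apply]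
    constructor
    · intro h w hw
      rw [← hT v ⟨w, hw⟩, h]; rfl
    · intro h
      ext1 w
      rw [hT, h w w.2]; rfl
  have hsurj : Function.Surjective (ev ∘ₗ T0) := by
    have h1 := LinearMap.finrank_range_add_finrank_ker (ev ∘ₗ T0)
    rw [hker, hu, Module.finrank_fin_fun] at h1
    rw [← LinearMap.range_eq_top]
    apply Submodule.eq_top_of_finrank_eq
    rw [Module.finrank_linearMap, hW2, Module.finrank_fin_fun]
    omega
  obtain ⟨v, hv⟩ := hsurj (ev e)
  have hz : ∀ w ∈ W, ∑ k, w k • (e k - A k *ᵥ v) = 0 := by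
    intro w hw
    have := LinearMap.congr_fun hv ⟨w, hw⟩
    simp only [smul_sub, Finset.sum_sub_distrib]
    rw [sub_eq_zero]
    exact this.symm
  refine ⟨v, (p k0)⁻¹ • (e k0 - A k0 *ᵥ v), fun k => ?_⟩
  have h2 := hz (Pi.single k (p k0) - Pi.single k0 (p k)) (by
    rw [hW, LinearMap.mem_ker, hL]
    simp only [Pi.sub_apply, sub_mul, Finset.sum_sub_distrib, Pi.single_apply, ite_mul, zero_mul,
      Finset.sum_ite_eq', Finset.mem_univ, if_true]
    ring)
  simp only [Pi.sub_apply, sub_smul, Finset.sum_sub_distrib, Pi.single_apply, ite_smul, zero_smul,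
    Finset.sum_ite_eq', Finset.mem_univ, if_true, sub_eq_zero] at h2
  rw [smul_comm, ← h2, smul_smul, inv_mul_cancel₀ hk0, one_smul]
  abel

lemma mem_homogPi {K : Type*} [Field K] {x : ℕ} (n : ℕ) (v : Fin x → MvPolynomial (Fin 3) K) :
    v ∈ homogPi K x n ↔ ∀ i, (v i).IsHomogeneous n := by
  simp [homogPi, Submodule.mem_pi]

instance homogPi_finite (K : Type*) [Field K] (x : ℕ) (n : ℕ) :
    Module.Finite K (homogPi K x n) := by
  let g : homogPi K x n →ₗ[K] (Fin x → homogeneousSubmodule (Fin 3) K n) :=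
    { toFun := fun v i => ⟨v.1 i, (mem_homogPi n v.1).1 v.2 i⟩
      map_add' := fun _ _ => rfl
      map_smul' := fun _ _ => rfl }
  refine Module.Finite.of_injective g fun v w h => ?_
  apply Subtype.ext
  ext1 i
  exact congrArg Subtype.val (congrFun h i)

/-- the linear form with coefficients `p` -/
noncomputable def lform {K : Type*} [Field K] (p : Fin 3 → K) : MvPolynomial (Fin 3) K :=
  ∑ k, C (p k) * X k

lemma step {K : Type*} [Field K] (c : ℕ)
    (A : Fin 3 → Matrix (Fin c) (Fin (2 * c + 2)) K)
    (huniform : ∀ W : Submodule K (Fin 3 → K), Module.finrank K W = 2 →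
      Module.finrank K
        (⨅ w ∈ W, LinearMap.ker (evalMat A w).mulVecLin :
          Submodule K (Fin (2 * c + 2) → K)) = 2)
    (p : Fin 3 → K) (hp : p ≠ 0) (n : ℕ) (h : Fin c → MvPolynomial (Fin 3) K)
    (hh : ∀ i, (h i).IsHomogeneous (n + 1)) :
    ∃ f ∈ homogPi K c n, h - lform p • f ∈
      Submodule.map (LinearMap.restrictScalars K (polyMat A).mulVecLin) (homogPi K (2 * c + 2) n) := by
  classical
  set N := Submodule.map (LinearMap.restrictScalars K (polyMat A).mulVecLin)
    (homogPi K (2 * c + 2) n) with hN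
  let D : Submodule K (Fin c → MvPolynomial (Fin 3) K) :=
    { carrier := {h | ∃ f ∈ homogPi K c n, h - lform p • f ∈ N}
      add_mem' := by
        rintro a b ⟨f, hf, hf'⟩ ⟨g, hg, hg'⟩
        refine ⟨f + g, add_mem hf hg, ?_⟩
        have := add_mem hf' hg'
        rw [smul_add]
        convert this using 1
        abel
      zero_mem' := ⟨0, zero_mem _, by simp⟩
      smul_mem' := by
        rintro a b ⟨f, hf, hf'⟩
        refine ⟨a • f, Submodule.smul_mem _ a hf, ?_⟩
        have := Submodule.smul_mem _ a hf'
        rw [smul_comm, ← smul_sub]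
        exact this }
  change h ∈ D
  have key : ∀ (i : Fin c) (m : Fin 3 →₀ ℕ), m.degree = n + 1 →
      Pi.single i (monomial m (1 : K)) ∈ D := by
    intro i m hm
    obtain ⟨k, hk⟩ : ∃ k, m k ≠ 0 := by
      by_contra! hcon
      have : m = 0 := by ext k; simp [hcon]
      rw [this] at hm
      simp at hm
    have h1 : Finsupp.single k 1 ≤ m := by
      rw [Finsupp.single_le_iff]
      omega
    obtain ⟨m', rfl⟩ : ∃ m', m = m' + Finsupp.single k 1 := ⟨_, (tsub_add_cancel_of_le h1).symm⟩
    have hm' : m'.degree = n := by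
      rw [map_add, Finsupp.degree_single] at hm
      omega
    have hmon : (monomial m' (1 : K)).IsHomogeneous n := isHomogeneous_monomial _ hm'
    obtain ⟨v, f, hvf⟩ := lin_step c A huniform p hp (Pi.single k (Pi.single i 1))
    refine ⟨fun j => monomial m' 1 * C (f j), ?_, fun j => monomial m' 1 * C (v j), ?_, ?_⟩
    · exact (mem_homogPi n _).2 fun j => by simpa using hmon.mul (isHomogeneous_C _ (f j))
    · exact (mem_homogPi n _).2 fun j => by simpa using hmon.mul (isHomogeneous_C _ (v j))
    · ext1 r
      simp only [LinearMap.restrictScalars_apply, Matrix.mulVecLin_apply, Pi.sub_apply,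
        Pi.smul_apply, smul_eq_mul]
      rw [polyMat_mulVec_apply, eq_sub_iff_add_eq, Finset.sum_comm, lform, Finset.sum_mul,
        ← Finset.sum_add_distrib]
      have h3 : ∀ k', (∑ j, C (A k' r j) * (X k' * (monomial m' 1 * C (v j)))) +
          C (p k') * X k' * (monomial m' 1 * C (f r)) =
          monomial m' 1 * X k' * C ((Pi.single k (Pi.single i 1) : Fin 3 → Fin c → K) k' r) := by
        intro k'
        rw [hvf k']
        simp only [Pi.add_apply, Pi.smul_apply, smul_eq_mul, Matrix.mulVec, dotProduct, map_add,
          map_sum, map_mul, mul_add, Finset.mul_sum]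
        congr 1
        · exact Finset.sum_congr rfl fun j _ => by ring
        · ring
      simp only [h3]
      rw [Finset.sum_eq_single k]
      · rw [Pi.single_eq_same]
        by_cases hr : r = i
        · subst hr
          simp [X, monomial_mul]
        · simp [Pi.single_eq_of_ne hr]
      · intro k' _ hk'
        simp [Pi.single_eq_of_ne hk']
      · simp
  have h4 : h = ∑ i, ∑ m ∈ (h i).support,
      coeff m (h i) • (Pi.single i (monomial m (1 : K)) : Fin c → MvPolynomial (Fin 3) K) := by
    ext1 r
    simp only [Finset.sum_apply, Pi.smul_apply]
    rw [Finset.sum_eq_single r]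
    · conv_lhs => rw [(h r).as_sum]
      refine Finset.sum_congr rfl fun m _ => ?_
      simp [smul_monomial]
    · intro i _ hi
      simp [Pi.single_eq_of_ne hi.symm]
    · simp
  rw [h4]
  refine sum_mem fun i _ => sum_mem fun m hm => Submodule.smul_mem _ _ (key i m ?_)
  by_contra hne
  exact (mem_support_iff.1 hm) ((hh i).coeff_eq_zero hne)

end Stmt10

/-- **Lemma 17.** For a 1-type uniform Steiner bundle `E` of minimal rank `c+2` on P²
with `c₁ = −c` (defined by a `c × (2c+2)` matrix `A` of linear forms with `A(p)` of rank
`c` for `p ≠ 0` and common kernel of dimension 2 over every 2-dimensional `W ⊆ K³`),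
one has `h¹(E(t+1)) ≤ max(0, h¹(E(t)) − 2)` for every `t ≥ −1`. -/
theorem stmt10 {K : Type*} [Field K] [IsAlgClosed K] [CharZero K]
    (c : ℕ) (hc : 2 ≤ c)
    (A : Fin 3 → Matrix (Fin c) (Fin (2 * c + 2)) K)
    (hrank : ∀ p : Fin 3 → K, p ≠ 0 → (evalMat A p).rank = c)
    (huniform : ∀ W : Submodule K (Fin 3 → K), Module.finrank K W = 2 →
      Module.finrank K
        (⨅ w ∈ W, LinearMap.ker (evalMat A w).mulVecLin :
          Submodule K (Fin (2 * c + 2) → K)) = 2) :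
    ∀ t : ℤ, -1 ≤ t → cokerDim A (t + 1) ≤ cokerDim A t - 2 := by

  intro t ht
  obtain ⟨n, rfl⟩ : ∃ n : ℕ, t = (n : ℤ) - 1 := ⟨(t + 1).toNat, by omega⟩
  have e1 : ((n : ℤ) - 1 + 1) = (n : ℤ) := by ring
  unfold cokerDim
  rw [e1]
  have e2 : ((n : ℤ) + 1) = ((n + 1 : ℕ) : ℤ) := by push_cast; rfl
  rw [e2]
  refine Stmt10.hopf_sub _ _ _ _ ?_ ?_
    (fun k => LinearMap.restrictScalars K
      (LinearMap.lsmul (MvPolynomial (Fin 3) K) (Fin c → MvPolynomial (Fin 3) K) (X k)))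
    ?_ ?_ ?_
  · rintro _ ⟨v, hv, rfl⟩
    rcases n with _ | n
    · have : v = 0 := by simpa [homogPi] using hv
      subst this
      simp
    · rw [show (((n + 1 : ℕ) : ℤ) - 1) = (n : ℤ) by push_cast; ring] at hv
      exact (Stmt10.mem_homogPi _ _).2
        (Stmt10.mulVec_isHomogeneous A v n ((Stmt10.mem_homogPi _ _).1 hv))
  · rintro _ ⟨v, hv, rfl⟩
    exact (Stmt10.mem_homogPi _ _).2
      (Stmt10.mulVec_isHomogeneous A v n ((Stmt10.mem_homogPi _ _).1 hv))
  · intro k h hh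
    refine (Stmt10.mem_homogPi _ _).2 fun i => ?_
    rw [add_comm n 1]
    exact (isHomogeneous_X K k).mul ((Stmt10.mem_homogPi _ _).1 hh i)
  · rintro k _ ⟨v, hv, rfl⟩
    refine ⟨(X k : MvPolynomial (Fin 3) K) • v, ?_, ?_⟩
    · rcases n with _ | n
      · have : v = 0 := by simpa [homogPi] using hv
        subst this
        simp
      · rw [show (((n + 1 : ℕ) : ℤ) - 1) = (n : ℤ) by push_cast; ring] at hv
        refine (Stmt10.mem_homogPi _ _).2 fun i => ?_
        rw [add_comm n 1]
        exact (isHomogeneous_X K k).mul ((Stmt10.mem_homogPi _ _).1 hv i)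
    · simp
  · intro p hp h hh
    obtain ⟨f, hf, hf'⟩ := Stmt10.step c A huniform p hp n h ((Stmt10.mem_homogPi _ _).1 hh)
    refine ⟨f, hf, ?_⟩
    convert hf' using 2
    ext1 i
    simp [Stmt10.lform, Finset.sum_mul, MvPolynomial.smul_eq_C_mul, mul_assoc]
end
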